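/- arXiv:1506.07022 — 3 statements merged into one kernel-verified Lean document; each statement's English description precedes it below -/
import Mathlib

section
/- Let λ and μ be partitions of n with K_{λμ} = 1 and ℓ(λ) = h < ℓ(μ) = l. Then in the unique semistandard Young tableau T of shape λ and weight μ, every entry greater than h lies in row h, and moreover μ_{h+1} + μ_{h+2} + ... + μ_l < λ_h. -/
/-- A partition encoded as a weakly decreasing, finitely supported function `ℕ → ℕ`
(0-indexed: `l 0` is the first part). -/
def IsPartition (l : ℕ → ℕ) : Prop :=
  Antitone l ∧ ∃ N, ∀ i, N ≤ i → l i = 0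

/-- The size (sum of the parts). -/
noncomputable def psize (l : ℕ → ℕ) : ℕ := ∑ᶠ i, l i

/-- Dominance order: every partial sum of `l` is at least that of `m`. -/
def Dominates (l m : ℕ → ℕ) : Prop :=
  ∀ k, ∑ i ∈ Finset.range k, m i ≤ ∑ i ∈ Finset.range k, l i

/-- `l` has exactly `h` (nonzero) parts. -/
def PartLength (l : ℕ → ℕ) (h : ℕ) : Prop :=
  (∀ i, i < h → 0 < l i) ∧ ∀ i, h ≤ i → l i = 0

/-- A semistandard Young tableau of shape `l`: positive entries in the cells
`(i, j)` with `j < l i`, zero outside, rows weakly increasing, columns strictly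
increasing. -/
def IsSSYT (l : ℕ → ℕ) (T : ℕ → ℕ → ℕ) : Prop :=
  (∀ i j, j < l i → 1 ≤ T i j) ∧
  (∀ i j, l i ≤ j → T i j = 0) ∧
  (∀ i j k, j ≤ k → k < l i → T i j ≤ T i k) ∧
  (∀ i i' j, i < i' → j < l i' → T i j < T i' j)

/-- The number of cells of `T` (inside shape `l`) with entry `m + 1`. -/
noncomputable def entryCount (l : ℕ → ℕ) (T : ℕ → ℕ → ℕ) (m : ℕ) : ℕ :=
  Set.ncard {p : ℕ × ℕ | p.2 < l p.1 ∧ T p.1 p.2 = m + 1}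

/-- `T` has weight `w`: the entry `m + 1` occurs `w m` times. -/
def HasWeight (l : ℕ → ℕ) (T : ℕ → ℕ → ℕ) (w : ℕ → ℕ) : Prop :=
  ∀ m, entryCount l T m = w m

/-- The Kostka number: the number of semistandard Young tableaux of shape `l`
and weight `w`. -/
noncomputable def kostka (l w : ℕ → ℕ) : ℕ :=
  Set.ncard {T : ℕ → ℕ → ℕ | IsSSYT l T ∧ HasWeight l T w}

theorem cells_finite {lam : ℕ → ℕ} {h : ℕ} (hz : ∀ i, h ≤ i → lam i = 0) (ha : Antitone lam) :
    {p : ℕ × ℕ | p.2 < lam p.1}.Finite := by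
  apply Set.Finite.subset (Finset.finite_toSet (Finset.range h ×ˢ Finset.range (lam 0)))
  rintro ⟨i, j⟩ hp
  simp only [Set.mem_ofPred_eq] at hp
  have h1 : i < h := by
    by_contra hc
    have := hz i (by omega)
    omega
  have h2 := ha (Nat.zero_le i)
  simp
  omega

theorem entry_perm (lam : ℕ → ℕ) (T T' : ℕ → ℕ → ℕ) (s : ℕ × ℕ → ℕ × ℕ)
    (hs : Function.Involutive s) (hcell : ∀ p : ℕ × ℕ, p.2 < lam p.1 → (s p).2 < lam (s p).1)
    (hT : ∀ i j, T' i j = T (s (i, j)).1 (s (i, j)).2) (m : ℕ) :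
    entryCount lam T' m = entryCount lam T m := by
  unfold entryCount
  rw [← Set.ncard_image_of_injective {p : ℕ × ℕ | p.2 < lam p.1 ∧ T p.1 p.2 = m + 1} hs.injective]
  congr 1
  ext p
  simp only [Set.mem_ofPred_eq, Set.mem_image]
  constructor
  · rintro ⟨h1, h2⟩
    refine ⟨s p, ⟨hcell p h1, ?_⟩, hs p⟩
    rw [← h2, hT]
  · rintro ⟨q, ⟨h1, h2⟩, rfl⟩
    refine ⟨hcell q h1, ?_⟩
    rw [hT, Prod.mk.eta, hs q, h2]

theorem col_add {lam : ℕ → ℕ} {T : ℕ → ℕ → ℕ} (hT : IsSSYT lam T) (ha : Antitone lam)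
    (r q d : ℕ) (h : q < lam (r + d)) : T r q + d ≤ T (r + d) q := by
  induction d with
  | zero => simp
  | succ d ih =>
    have h1 : lam (r + (d + 1)) ≤ lam (r + d) := ha (by omega)
    have := ih (by omega)
    have := hT.2.2.2 (r + d) (r + (d + 1)) q (by omega) h
    omega

/-- Exchange lemma. -/
theorem exchange {lam : ℕ → ℕ} {T : ℕ → ℕ → ℕ} (hT : IsSSYT lam T) (hanti : Antitone lam)
    (i p m x j : ℕ) (c : ℕ → ℕ) (hip : i < p) (hm : m ≤ i)
    (hac : ∀ t ≤ m, c t < lam (p - t)) (hav : ∀ t ≤ m, T (p - t) (c t) + 1 + t = x)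
    (hlast : ∀ t ≤ m, ∀ q, c t < q → q < lam (p - t) → x ≤ T (p - t) q + t)
    (hbc : ∀ t ≤ m, j < lam (i - t)) (hbv : ∀ t ≤ m, T (i - t) j + t = x)
    (hfirst : ∀ t ≤ m, ∀ q < j, T (i - t) q + t < x)
    (htop : m < i → T (i - m - 1) j + m + 1 < x)
    (hbelow : ∀ r > p, ∀ q < lam r, x < T r q) :
    ∃ T', IsSSYT lam T' ∧ (∀ v, entryCount lam T' v = entryCount lam T v) ∧ T' ≠ T := by
  classical
  let A : ℕ → ℕ → Prop := fun r q => r ≤ p ∧ p - r ≤ m ∧ q = c (p - r)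
  let B : ℕ → ℕ → Prop := fun r q => r ≤ i ∧ i - r ≤ m ∧ q = j
  -- values on A and B
  have hAv : ∀ r q, A r q → q < lam r ∧ T r q + 1 + (p - r) = x := by
    rintro r q ⟨h1, h2, rfl⟩
    have e : p - (p - r) = r := by omega
    have := hac _ h2
    have := hav _ h2
    rw [e] at *
    exact ⟨by assumption, by assumption⟩
  have hBv : ∀ r q, B r q → q < lam r ∧ T r q + (i - r) = x := by
    rintro r q ⟨h1, h2, rfl⟩
    have e : i - (i - r) = r := by omega
    have := hbc _ h2
    have := hbv _ h2
    rw [e] at *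
    exact ⟨by assumption, by assumption⟩
  have hAl : ∀ r q, A r q → ∀ k, q < k → k < lam r → x ≤ T r k + (p - r) := by
    rintro r q ⟨h1, h2, rfl⟩ k hk hk'
    have e : p - (p - r) = r := by omega
    have := hlast _ h2 k hk (by rw [e]; exact hk')
    rwa [e] at this
  have hBf : ∀ r q, B r q → ∀ k, k < q → T r k + (i - r) < x := by
    rintro r q ⟨h1, h2, rfl⟩ k hk
    have e : i - (i - r) = r := by omega
    have := hfirst _ h2 k hk
    rwa [e] at this
  have hAB : ∀ r q, A r q → ¬ B r q := by
    intro r q h1 h2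
    have e1 := hAv r q h1
    have e2 := hBv r q h2
    have := h2.1
    omega
  let s : ℕ × ℕ → ℕ × ℕ := fun z =>
    if A z.1 z.2 then (i - (p - z.1), j)
    else if B z.1 z.2 then (p - (i - z.1), c (i - z.1)) else z
  have hAtoB : ∀ r q, A r q → B (i - (p - r)) j := by
    rintro r q ⟨h1, h2, h3⟩
    exact ⟨by omega, by omega, rfl⟩
  have hBtoA : ∀ r q, B r q → A (p - (i - r)) (c (i - r)) := by
    rintro r q ⟨h1, h2, h3⟩
    refine ⟨by omega, by omega, ?_⟩
    congr 1
    omega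
  have sA : ∀ r q, A r q → s (r, q) = (i - (p - r), j) := by
    intro r q h; simp only [s, if_pos h]
  have sB : ∀ r q, B r q → s (r, q) = (p - (i - r), c (i - r)) := by
    intro r q h
    have : ¬ A r q := fun h' => hAB r q h' h
    simp only [s, if_neg this, if_pos h]
  have sN : ∀ r q, ¬ A r q → ¬ B r q → s (r, q) = (r, q) := by
    intro r q h h'
    simp only [s, if_neg h, if_neg h']
  have hs : Function.Involutive s := by
    rintro ⟨r, q⟩
    by_cases h : A r q
    · rw [sA r q h, sB _ _ (hAtoB r q h)]
      obtain ⟨h1, h2, h3⟩ := h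
      have e : i - (i - (p - r)) = p - r := by omega
      rw [e, ← h3]
      congr 1
      omega
    · by_cases h' : B r q
      · rw [sB r q h', sA _ _ (hBtoA r q h')]
        obtain ⟨h1, h2, h3⟩ := h'
        rw [h3]
        congr 1
        omega
      · rw [sN r q h h', sN r q h h']
  let T' : ℕ → ℕ → ℕ := fun r q => T (s (r, q)).1 (s (r, q)).2
  have tA : ∀ r q, A r q → T' r q = T r q + 1 := by
    intro r q h
    have h1 := hAv r q h
    have h2 := hBv _ _ (hAtoB r q h)
    have : T' r q = T (i - (p - r)) j := by simp only [T', sA r q h]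
    have := h.1
    have := h.2.1
    omega
  have tB : ∀ r q, B r q → T' r q + 1 = T r q := by
    intro r q h
    have h1 := hBv r q h
    have h2 := hAv _ _ (hBtoA r q h)
    have : T' r q = T (p - (i - r)) (c (i - r)) := by simp only [T', sB r q h]
    have := h.1
    have := h.2.1
    omega
  have tN : ∀ r q, ¬ A r q → ¬ B r q → T' r q = T r q := by
    intro r q h h'
    simp only [T', sN r q h h']
  have hpos : ∀ r q, q < lam r → r + 1 ≤ T r q := by
    intro r q h
    have := col_add hT hanti 0 q r (by simpa using h)
    have h0 := hT.1 0 q (lt_of_lt_of_le h (hanti (Nat.zero_le r)))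
    simp only [Nat.zero_add] at this
    omega
  refine ⟨T', ⟨?_, ?_, ?_, ?_⟩, ?_, ?_⟩
  · intro r q h
    by_cases hA : A r q
    · have := tA r q hA
      omega
    · by_cases hB : B r q
      · have h1 := hBv r q hB
        have h2 := hAv _ _ (hBtoA r q hB)
        have h3 := hT.1 _ _ h2.1
        have : T' r q = T (p - (i - r)) (c (i - r)) := by simp only [T', sB r q hB]
        omega
      · rw [tN r q hA hB]
        exact hT.1 r q h
  · intro r q h
    have hA : ¬ A r q := fun h' => by have := (hAv r q h').1; omega
    have hB : ¬ B r q := fun h' => by have := (hBv r q h').1; omega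
    rw [tN r q hA hB]
    exact hT.2.1 r q h
  · intro r q k hqk hk
    rcases Nat.eq_or_lt_of_le hqk with rfl | hlt
    · exact le_rfl
    have hle := hT.2.2.1 r q k hqk hk
    by_cases hA : A r q
    · have e1 := tA r q hA
      have e2 := hAv r q hA
      have e3 := hAl r q hA k hlt hk
      by_cases hA' : A r k
      · have := tA r k hA'
        omega
      · by_cases hB' : B r k
        · have := tB r k hB'
          have := hBv r k hB'
          have := hB'.1
          omega
        · have := tN r k hA' hB'
          omega
    · have e1 : T' r q ≤ T r q := by
        by_cases hB : B r q
        · have := tB r q hB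
          omega
        · rw [tN r q hA hB]
      by_cases hA' : A r k
      · have := tA r k hA'
        omega
      · by_cases hB' : B r k
        · have := tB r k hB'
          have := hBv r k hB'
          have := hBf r k hB' q hlt
          omega
        · have := tN r k hA' hB'
          omega
  · intro r r' q hr hq
    obtain ⟨d, rfl⟩ : ∃ d, r' = r + 1 + d := ⟨r' - (r + 1), by omega⟩
    have hq1 : q < lam (r + 1) := lt_of_lt_of_le hq (hanti (by omega))
    have g1 := hT.2.2.2 r (r + 1) q (by omega) hq1
    have g2 := col_add hT hanti (r + 1) q d hq
    by_cases hA : A r q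
    · have e1 := tA r q hA
      have e2 := hAv r q hA
      by_cases hA' : A (r + 1 + d) q
      · have := tA _ q hA'
        omega
      · by_cases hB' : B (r + 1 + d) q
        · have := tB _ q hB'
          have := hBv _ q hB'
          have := hB'.1
          omega
        · rw [tN _ q hA' hB', e1]
          by_contra hc
          have hd : d = 0 := by omega
          subst hd
          have hv : T (r + 1) q = T r q + 1 := by
            simp only [Nat.add_zero] at *
            omega
          simp only [Nat.add_zero] at *
          by_cases hrp : r = p
          · have := hbelow (r + 1) (by omega) q hq
            omega
          · have hrp' := hA.1
            have hrm := hA.2.1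
            have hAn : A (r + 1) (c (p - (r + 1))) := ⟨by omega, by omega, rfl⟩
            have f1 := hAv _ _ hAn
            rcases lt_trichotomy q (c (p - (r + 1))) with h | h | h
            · have f2 := hAl r q hA _ h (lt_of_lt_of_le f1.1 (hanti (by omega)))
              have f3 := hT.2.2.2 r (r + 1) _ (by omega) f1.1
              omega
            · rw [← h] at hAn
              exact hA' hAn
            · have f2 := hAl _ _ hAn q h hq
              omega
    · have e1 : T' r q ≤ T r q := by
        by_cases hB : B r q
        · have := tB r q hB
          omega
        · rw [tN r q hA hB]
      by_cases hA' : A (r + 1 + d) q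
      · have := tA _ q hA'
        omega
      · by_cases hB' : B (r + 1 + d) q
        · have f1 := tB _ q hB'
          have f2 := hBv _ q hB'
          by_contra hc
          have hd : d = 0 := by omega
          subst hd
          simp only [Nat.add_zero] at *
          have hri := hB'.1
          have hrm := hB'.2.1
          have hrj := hB'.2.2
          by_cases hmm : i - r ≤ m
          · have := tB r q ⟨by omega, hmm, hrj⟩
            omega
          · have ht := htop (by omega)
            have e : i - m - 1 = r := by omega
            rw [e, ← hrj] at ht
            omega
        · rw [tN _ q hA' hB']
          omega
  · intro v
    apply entry_perm lam T T' s hs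
    · rintro ⟨r, q⟩ h
      by_cases hA : A r q
      · rw [sA r q hA]
        exact (hBv _ _ (hAtoB r q hA)).1
      · by_cases hB : B r q
        · rw [sB r q hB]
          exact (hAv _ _ (hBtoA r q hB)).1
        · rw [sN r q hA hB]
          exact h
    · intro r q
      rfl
  · intro heq
    have hBB : B i j := ⟨le_rfl, by omega, rfl⟩
    have := tB i j hBB
    rw [heq] at this
    omega

theorem exists_last (P : ℕ → Prop) (N : ℕ) (h : ∃ q < N, P q) :
    ∃ q, q < N ∧ P q ∧ ∀ k, q < k → k < N → ¬ P k := by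
  classical
  obtain ⟨q, hq, hP⟩ := h
  refine ⟨Nat.findGreatest (fun k => k < N ∧ P k) N, ?_⟩
  have h1 := Nat.findGreatest_spec (P := fun k => k < N ∧ P k) (n := N) hq.le ⟨hq, hP⟩
  refine ⟨h1.1, h1.2, ?_⟩
  intro k hk hkN hPk
  exact Nat.findGreatest_is_greatest (P := fun k => k < N ∧ P k) hk hkN.le ⟨hkN, hPk⟩

theorem rows_lemma {lam : ℕ → ℕ} {T : ℕ → ℕ → ℕ} (hT : IsSSYT lam T) (hanti : Antitone lam)
    (huniq : ∀ T', IsSSYT lam T' → (∀ v, entryCount lam T' v = entryCount lam T v) → T' = T)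
    (hocc : ∀ v w, 1 ≤ v → v ≤ w → (∃ r q, q < lam r ∧ T r q = w) → ∃ r q, q < lam r ∧ T r q = v)
    (p : ℕ) (hp : 0 < lam p) (hp0 : ∀ g ≤ p, T g 0 = g + 1) (y : ℕ) :
    p + 1 < y → (∀ r > p, ∀ q < lam r, y < T r q) → ∀ i < p, ∀ j < lam i, T i j ≠ y := by
  classical
  induction y with
  | zero => intro h; omega
  | succ z ih =>
  intro hy hbelow i hip j0 hj0 hv
  -- first occurrence
  obtain ⟨j, hj, hjv, hjf⟩ : ∃ j, j < lam i ∧ T i j = z + 1 ∧ ∀ q < j, T i q < z + 1 := by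
    have hex : ∃ j, j < lam i ∧ T i j = z + 1 := ⟨j0, hj0, hv⟩
    refine ⟨Nat.find hex, (Nat.find_spec hex).1, (Nat.find_spec hex).2, ?_⟩
    intro q hq
    have h1 := Nat.find_min hex hq
    have h2 := hT.2.2.1 i q _ hq.le (Nat.find_spec hex).1
    rw [(Nat.find_spec hex).2] at h2
    have h3 : q < lam i := lt_trans hq (Nat.find_spec hex).1
    have h4 : T i q ≠ z + 1 := fun h => h1 ⟨h3, h⟩
    omega
  have hjc : ∀ t, j < lam (i - t) := fun t => lt_of_lt_of_le hj (hanti (by omega))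
  -- chain length
  obtain ⟨m, hmi, hmv, hmtop⟩ : ∃ m ≤ i, (∀ t ≤ m, T (i - t) j + t = z + 1) ∧
      (m < i → T (i - m - 1) j + m + 1 < z + 1) := by
    let P : ℕ → Prop := fun m => ∀ t ≤ m, T (i - t) j + t = z + 1
    have hP0 : P 0 := by
      intro t ht
      obtain rfl : t = 0 := by omega
      simpa using hjv
    have hs := Nat.findGreatest_spec (P := P) (n := i) (Nat.zero_le i) hP0
    refine ⟨Nat.findGreatest P i, Nat.findGreatest_le i, hs, ?_⟩
    intro hlt
    set m := Nat.findGreatest P i with hmdef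
    have hn : ¬ P (m + 1) := Nat.findGreatest_is_greatest (P := P) (n := i) (by omega) (by omega)
    have h1 := hs m le_rfl
    have h2 := hT.2.2.2 (i - m - 1) (i - m) j (by omega) (hjc m)
    by_contra hc
    apply hn
    intro t ht
    rcases Nat.lt_or_ge m t with h | h
    · obtain rfl : t = m + 1 := by omega
      have e : i - (m + 1) = i - m - 1 := by omega
      rw [e]
      omega
    · exact hs t h
  have hf : ∀ t ≤ i, ∀ q < j, T (i - t) q + t < z + 1 := by
    intro t ht q hq
    have := col_add hT hanti (i - t) q t (by
      have e : i - t + t = i := by omega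
      rw [e]; omega)
    have e : i - t + t = i := by omega
    rw [e] at this
    have := hjf q hq
    omega
  have hex : ∀ t ≤ m, ∃ q < lam (p - t), T (p - t) q + 1 + t = z + 1 := by
    by_cases hz : z = p + 1
    · intro t ht
      refine ⟨0, lt_of_lt_of_le hp (hanti (by omega)), ?_⟩
      rw [hp0 _ (by omega)]
      omega
    · have hnot := ih (by omega) (fun r hr q hq => by have := hbelow r hr q hq; omega)
      have hm0 : m = 0 := by
        by_contra hc
        have h1 := hmv 1 (by omega)
        exact hnot (i - 1) (by omega) j (hjc 1) (by omega)
      intro t ht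
      obtain rfl : t = 0 := by omega
      obtain ⟨r, q, hq, hrq⟩ := hocc z (z + 1) (by omega) (by omega) ⟨i, j, hj, hjv⟩
      have hrp : r = p := by
        rcases lt_trichotomy r p with h | h | h
        · exact absurd hrq (hnot r h q hq)
        · exact h
        · have := hbelow r h q hq
          omega
      subst hrp
      exact ⟨q, by simpa using hq, by simp [hrq]⟩
  have hex2 : ∀ t, ∃ q, t ≤ m → (q < lam (p - t) ∧ T (p - t) q + 1 + t = z + 1 ∧
      ∀ k, q < k → k < lam (p - t) → ¬ (T (p - t) k + 1 + t = z + 1)) := by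
    intro t
    by_cases ht : t ≤ m
    · obtain ⟨q, hq⟩ := exists_last _ _ (hex t ht)
      exact ⟨q, fun _ => hq⟩
    · exact ⟨0, fun h => absurd h ht⟩
  choose c hc using hex2
  obtain ⟨T', h1, h2, h3⟩ := exchange hT hanti i p m (z + 1) j c hip hmi
    (fun t ht => (hc t ht).1) (fun t ht => (hc t ht).2.1)
    (by
      intro t ht q hq hq'
      have a1 := (hc t ht).2.2 q hq hq'
      have a2 := (hc t ht).2.1
      have a3 := hT.2.2.1 (p - t) _ q hq.le hq'
      omega)
    (fun t _ => hjc t) hmv (fun t ht => hf t (by omega)) hmtop hbelow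
  exact h3 (huniq T' h1 h2)

theorem first_col {lam mu : ℕ → ℕ} {T : ℕ → ℕ → ℕ} (hT : IsSSYT lam T) (hanti : Antitone lam)
    (huniq : ∀ T', IsSSYT lam T' → (∀ v, entryCount lam T' v = entryCount lam T v) → T' = T)
    (hocc : ∀ v w, 1 ≤ v → v ≤ w → (∃ r q, q < lam r ∧ T r q = w) → ∃ r q, q < lam r ∧ T r q = v)
    (hfin : {p : ℕ × ℕ | p.2 < lam p.1}.Finite)
    (hw : HasWeight lam T mu) (hmu : Antitone mu)
    (g : ℕ) : 0 < lam g → T g 0 = g + 1 := by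
  classical
  induction g using Nat.strong_induction_on with
  | _ g ih =>
  intro hg
  by_contra hne
  have hall : ∀ r, g ≤ r → ∀ q < lam r, T g 0 ≤ T r q := by
    intro r hr q hq
    have hq' : q < lam g := lt_of_lt_of_le hq (hanti hr)
    have h1 := hT.2.2.1 g 0 q (Nat.zero_le q) hq'
    rcases Nat.eq_or_lt_of_le hr with rfl | h
    · exact h1
    · have := hT.2.2.2 g r q h hq
      omega
  rcases Nat.eq_zero_or_pos g with rfl | hgpos
  · have h1 := hT.1 0 0 hg
    obtain ⟨r, q, hq, hrq⟩ := hocc 1 (T 0 0) le_rfl h1 ⟨0, 0, hg, rfl⟩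
    have := hall r (Nat.zero_le r) q hq
    omega
  · obtain ⟨p, rfl⟩ : ∃ p, g = p + 1 := ⟨g - 1, by omega⟩
    have hlp : lam (p + 1) ≤ lam p := hanti (by omega)
    have hp0 : ∀ g ≤ p, T g 0 = g + 1 := fun g hgp =>
      ih g (by omega) (lt_of_lt_of_le hg (hanti (by omega)))
    have h2 := hT.2.2.2 p (p + 1) 0 (by omega) hg
    have h3 := hp0 p le_rfl
    obtain ⟨y, hy⟩ : ∃ y, T (p + 1) 0 = y + 1 := ⟨T (p + 1) 0 - 1, by omega⟩
    have hy2 : p + 1 < y := by omega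
    have hrow : ∀ r q, q < lam r → T r q = y → r = p := by
      intro r q hq hrq
      rcases lt_trichotomy r p with h | h | h
      · refine absurd hrq (rows_lemma hT hanti huniq hocc p (by omega) hp0 y hy2 ?_ r h q hq)
        intro r hr q hq
        have := hall r hr q hq
        omega
      · exact h
      · have := hall r h q hq
        omega
    obtain ⟨r, q, hq, hrq⟩ := hocc y (y + 1) (by omega) (by omega) ⟨p + 1, 0, hg, hy⟩
    have := hrow r q hq hrq
    subst this
    obtain ⟨c, hc, hcv, hcl⟩ := exists_last (fun q => T r q = y) (lam r) ⟨q, hq, hrq⟩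
    have hc0 : 0 < c := by
      rcases Nat.eq_zero_or_pos c with rfl | h
      · omega
      · exact h
    -- the cell below c is not y+1
    have hbel : c < lam (r + 1) → y + 1 < T (r + 1) c := by
      intro hcr
      have b1 := hT.2.2.1 (r + 1) 0 c (Nat.zero_le c) hcr
      by_contra hcon
      have b2 : ∀ k ≤ c, T (r + 1) k = y + 1 := by
        intro k hk
        have := hT.2.2.1 (r + 1) k c hk hcr
        have := hT.2.2.1 (r + 1) 0 k (Nat.zero_le k) (by omega)
        omega
      have c1 : c + 1 ≤ mu y := by
        rw [← hw y]
        unfold entryCount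
        have : ((Finset.range (c + 1)).image (fun k => (r + 1, k))).card = c + 1 := by
          rw [Finset.card_image_of_injective _ (fun a b h => by simpa using h)]
          simp
        rw [← this, ← Set.ncard_coe_finset]
        apply Set.ncard_le_ncard
        · intro z hz
          simp only [Finset.coe_image, Set.mem_image, Finset.mem_coe, Finset.mem_range] at hz
          obtain ⟨k, hk, rfl⟩ := hz
          exact ⟨by simp only; omega, b2 k (by omega)⟩
        · exact hfin.subset (fun z hz => hz.1)
      have c2 : mu (y - 1) ≤ c := by
        rw [← hw (y - 1)]
        unfold entryCount
        have : ((Finset.Icc 1 c).image (fun k => (r, k))).card = c := by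
          rw [Finset.card_image_of_injective _ (fun a b h => by simpa using h)]
          simp
        rw [← this, ← Set.ncard_coe_finset]
        apply Set.ncard_le_ncard _ (Finset.finite_toSet _)
        rintro ⟨a, k⟩ ⟨hz1, hz2⟩
        simp only at hz1 hz2
        have e : y - 1 + 1 = y := by omega
        rw [e] at hz2
        have := hrow a k hz1 hz2
        subst this
        have k1 : k ≠ 0 := by rintro rfl; omega
        have k2 : k ≤ c := by
          by_contra hk
          exact hcl k (by omega) hz1 hz2
        simp
        omega
      have := hmu (show y - 1 ≤ y by omega)
      omega
    -- swap
    let T' : ℕ → ℕ → ℕ := fun a b =>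
      if a = r ∧ b = c then y + 1 else if a = r + 1 ∧ b = 0 then y else T a b
    have t1 : ∀ a b, T' a b = if a = r ∧ b = c then y + 1 else if a = r + 1 ∧ b = 0 then y
      else T a b := fun a b => rfl
    have hS : IsSSYT lam T' := by
      refine ⟨?_, ?_, ?_, ?_⟩
      · intro a b hab
        have := hT.1 a b hab
        rw [t1]
        split_ifs <;> omega
      · intro a b hab
        have := hT.2.1 a b hab
        rw [t1]
        split_ifs with h h'
        · obtain ⟨rfl, rfl⟩ := h
          omega
        · obtain ⟨rfl, rfl⟩ := h'
          omega
        · exact this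
      · intro a b k hbk hk
        have u1 := hT.2.2.1 a b k hbk hk
        by_cases e1 : a = r
        · subst e1
          have u2 : c < k → T a k ≠ y := fun h => hcl k h hk
          have u3 : b = c → T a b = y := by rintro rfl; exact hcv
          have u4 : k = c → T a k = y := by rintro rfl; exact hcv
          rw [t1, t1]
          split_ifs <;> omega
        · have u3 : a = r + 1 → T a 0 ≤ T a k := fun h => hT.2.2.1 a 0 k (Nat.zero_le k) hk
          have u4 : a = r + 1 → T a 0 = y + 1 := by rintro rfl; exact hy
          by_cases hb : b = 0
          · subst hb
            rw [t1, t1]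
            split_ifs <;> omega
          · rw [t1, t1]
            split_ifs <;> omega
      · intro a a' b haa hb
        have u1 := hT.2.2.2 a a' b haa hb
        by_cases hb0 : b = 0
        · subst hb0
          have u2 : a' = r + 1 → T a 0 < y := by
            rintro rfl
            have := hp0 a (by omega)
            omega
          have u3 : a = r + 1 → T a 0 = y + 1 := by rintro rfl; exact hy
          rw [t1, t1]
          split_ifs <;> omega
        · have u2 : a = r → b = c → y + 1 < T a' b := by
            rintro rfl rfl
            have v0 : b < lam (a + 1) := lt_of_lt_of_le hb (hanti (by omega))
            have v1 := hbel v0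
            rcases Nat.eq_or_lt_of_le (show a + 1 ≤ a' by omega) with h | h
            · rw [← h]; exact v1
            · have := hT.2.2.2 (a + 1) a' b h hb
              omega
          have u3 : a' = r → b = c → T a b < y := by
            rintro rfl rfl
            omega
          rw [t1, t1]
          split_ifs <;> grind
    have hW : ∀ v, entryCount lam T' v = entryCount lam T v := by
      intro v
      apply entry_perm lam T T' (Equiv.swap (r, c) (r + 1, 0))
      · intro z
        simp
      · rintro ⟨a, b⟩ hab
        by_cases e1 : (a, b) = (r, c)
        · rw [e1, Equiv.swap_apply_left]
          exact hg
        · by_cases e2 : (a, b) = (r + 1, 0)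
          · rw [e2, Equiv.swap_apply_right]
            exact hc
          · rw [Equiv.swap_apply_of_ne_of_ne e1 e2]
            exact hab
      · intro a b
        rw [t1]
        by_cases e1 : (a, b) = (r, c)
        · rw [e1, Equiv.swap_apply_left]
          simp only [Prod.mk.injEq] at e1
          rw [if_pos e1, hy]
        · by_cases e2 : (a, b) = (r + 1, 0)
          · rw [e2, Equiv.swap_apply_right]
            simp only [Prod.mk.injEq] at e1 e2
            rw [if_neg e1, if_pos e2, hcv]
          · rw [Equiv.swap_apply_of_ne_of_ne e1 e2]
            simp only [Prod.mk.injEq] at e1 e2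
            rw [if_neg e1, if_neg e2]
    have heq := huniq T' hS hW
    have := t1 r c
    rw [heq, if_pos ⟨rfl, rfl⟩] at this
    omega

theorem stmt7 (n h l : ℕ) (lam mu : ℕ → ℕ)
    (hlp : IsPartition lam) (hln : psize lam = n)
    (hmp : IsPartition mu) (hmn : psize mu = n)
    (hk : kostka lam mu = 1)
    (hlh : PartLength lam h) (hml : PartLength mu l) (hhl : h < l) :
    ∀ T, IsSSYT lam T → HasWeight lam T mu →
      (∀ i j, j < lam i → h < T i j → i = h - 1) ∧
      (∑ i ∈ Finset.Ico h l, mu i < lam (h - 1)) := by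
  classical
  intro T hT hw
  have hanti := hlp.1
  have hfin := cells_finite hlh.2 hanti
  have huniq : ∀ T', IsSSYT lam T' → (∀ v, entryCount lam T' v = entryCount lam T v) → T' = T := by
    intro T' h1 h2
    obtain ⟨S, hS⟩ := Set.ncard_eq_one.mp hk
    have a1 : T ∈ ({S} : Set (ℕ → ℕ → ℕ)) := by
      rw [← hS]; exact ⟨hT, hw⟩
    have a2 : T' ∈ ({S} : Set (ℕ → ℕ → ℕ)) := by
      rw [← hS]; exact ⟨h1, fun v => (h2 v).trans (hw v)⟩
    rw [Set.mem_singleton_iff] at a1 a2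
    rw [a1, a2]
  have hocc1 : ∀ v, 0 < mu v → ∃ r q, q < lam r ∧ T r q = v + 1 := by
    intro v hv
    rw [← hw v] at hv
    obtain ⟨⟨r, q⟩, h1, h2⟩ := Set.nonempty_of_ncard_ne_zero (Nat.pos_iff_ne_zero.mp hv)
    exact ⟨r, q, h1, h2⟩
  have hocc : ∀ v w, 1 ≤ v → v ≤ w → (∃ r q, q < lam r ∧ T r q = w) →
      ∃ r q, q < lam r ∧ T r q = v := by
    rintro v w h1 h2 ⟨r, q, h3, h4⟩
    have h5 : 0 < mu (w - 1) := by
      rw [← hw (w - 1)]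
      refine (Set.ncard_pos (hfin.subset (fun z hz => hz.1))).mpr ⟨(r, q), h3, ?_⟩
      simp only
      omega
    have h6 := hmp.1 (show v - 1 ≤ w - 1 by omega)
    obtain ⟨r', q', h7, h8⟩ := hocc1 (v - 1) (by omega)
    exact ⟨r', q', h7, by omega⟩
  have hcol := first_col hT hanti huniq hocc hfin hw hmp.1
  have hh : 0 < h := by
    obtain ⟨r, q, h1, h2⟩ := hocc1 0 (hml.1 0 (by omega))
    by_contra hc
    have := hlh.2 r (by omega)
    omega
  obtain ⟨p, rfl⟩ : ∃ p, h = p + 1 := ⟨h - 1, by omega⟩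
  simp only [Nat.add_sub_cancel]
  have hp : 0 < lam p := hlh.1 p (by omega)
  have hrows : ∀ i j, j < lam i → p + 1 < T i j → i = p := by
    intro i j hj hij
    rcases lt_trichotomy i p with h | h | h
    · refine absurd rfl (rows_lemma hT hanti huniq hocc p hp
        (fun g hg => hcol g (hlh.1 g (by omega))) (T i j) hij ?_ i h j hj)
      intro r hr q hq
      have := hlh.2 r (by omega)
      omega
    · exact h
    · have := hlh.2 i (by omega)
      omega
  refine ⟨hrows, ?_⟩
  have hle : ∀ v ∈ Finset.Ico (p + 1) l,
      mu v ≤ ((Finset.Ico 1 (lam p)).filter (fun q => T p q = v + 1)).card := by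
    intro v hv
    rw [Finset.mem_Ico] at hv
    rw [← hw v]
    unfold entryCount
    rw [← Finset.card_image_of_injective (f := fun k => (p, k)) _ (fun a b h => by simpa using h),
      ← Set.ncard_coe_finset]
    apply Set.ncard_le_ncard _ (Finset.finite_toSet _)
    rintro ⟨a, k⟩ ⟨hz1, hz2⟩
    simp only at hz1 hz2
    have := hrows a k hz1 (by omega)
    subst this
    have k1 : k ≠ 0 := by
      rintro rfl
      have := hcol a hp
      omega
    simp
    omega
  have h1 := Finset.sum_le_sum hle
  have h2 : ∑ v ∈ Finset.Ico (p + 1) l,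
      ((Finset.Ico 1 (lam p)).filter (fun q => T p q = v + 1)).card ≤ (Finset.Ico 1 (lam p)).card := by
    rw [← Finset.card_biUnion]
    · apply Finset.card_le_card
      intro q hq
      simp only [Finset.mem_biUnion, Finset.mem_filter] at hq
      obtain ⟨_, _, h, _⟩ := hq
      exact h
    · intro a _ b _ hab
      rw [Function.onFun, Finset.disjoint_left]
      intro q h1 h2
      simp only [Finset.mem_filter] at h1 h2
      omega
  rw [Nat.card_Ico] at h2
  omega
end

section
/- Let [λ(j)] be an r-multipartition of n and μ a partition of n with ℓ(μ) = l. Then K_{[λ(j)]μ} = 1 if and only if there exist indices 0 = i_0 < i_1 < ... < i_t = l such that for each k = 1,...,t, setting λ(j)^k = (λ(j)_{i_{k-1}+1},...,λ(j)_{i_k}) (with λ(j)_i = 0 for i > ℓ(λ(j))) and μ^k = (μ_{i_{k-1}+1},...,μ_{i_k}), one has: (1) the sum partition of [λ(j)^k] dominates μ^k, and (2) for at most one j, either λ(j)_{i_{k-1}+1} = ... = λ(j)_{i_k-1} > λ(j)_{i_k} or λ(j)_{i_{k-1}+1} > λ(j)_{i_{k-1}+2} = ... = λ(j)_{i_k},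 and for every other j all of λ(j)_{i_{k-1}+1},...,λ(j)_{i_k} are equal. -/
/-- A multitableau has total weight `w`. -/
def MultiHasWeight {r : ℕ} (lam : Fin r → ℕ → ℕ) (T : Fin r → ℕ → ℕ → ℕ) (w : ℕ → ℕ) : Prop :=
  ∀ m, (∑ j, entryCount (lam j) (T j) m) = w m

/-- The multipartition Kostka number: the number of semistandard Young
`r`-multitableaux of shape `lam` and total weight `w`. -/
noncomputable def kostkaMulti {r : ℕ} (lam : Fin r → ℕ → ℕ) (w : ℕ → ℕ) : ℕ :=
  Set.ncard {T : Fin r → ℕ → ℕ → ℕ | (∀ j, IsSSYT (lam j) (T j)) ∧ MultiHasWeight lam T w}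

/-- The partition `λ̃` with `λ̃ i = ∑ j, λ(j) i`. -/
def tildePart {r : ℕ} (lam : Fin r → ℕ → ℕ) : ℕ → ℕ := fun i => ∑ j, lam j i

open Finset

/-- Goodness of the block `[a, b)`. -/
def Good {r : ℕ} (lam : Fin r → ℕ → ℕ) (a b : ℕ) : Prop :=
  (∀ j j' : Fin r,
      ¬ (∀ x y, a ≤ x → x ≤ y → y < b → lam j x = lam j y) →
      ¬ (∀ x y, a ≤ x → x ≤ y → y < b → lam j' x = lam j' y) → j = j') ∧
  (∀ j : Fin r,
      (∀ x y, a ≤ x → x ≤ y → y < b → lam j x = lam j y) ∨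
      ((lam j (b - 1) < lam j a ∧
         ∀ x y, a ≤ x → x ≤ y → y + 1 < b → lam j x = lam j y) ∨
       (lam j (a + 1) < lam j a ∧
         ∀ x y, a + 1 ≤ x → x ≤ y → y < b → lam j x = lam j y)))

/-- Gelfand-Tsetlin style patterns. -/
structure Pat {r : ℕ} (s : ℕ) (lam : Fin r → ℕ → ℕ) (mu : ℕ → ℕ)
    (c : ℕ → Fin r → ℕ → ℕ) : Prop where
  zero : ∀ j i, c 0 j i = 0
  top : ∀ m, s ≤ m → c m = lam
  mono : ∀ m j i, c m j i ≤ c (m + 1) j i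
  diag : ∀ m j i, c (m + 1) j (i + 1) ≤ c m j i
  sum : ∀ m, m ≤ s → ∑ i ∈ range m, tildePart (c m) i = ∑ i ∈ range m, mu i

/-- Feasible one-step restriction. -/
structure Feas {r : ℕ} (s : ℕ) (lam : Fin r → ℕ → ℕ) (mu : ℕ → ℕ)
    (k : Fin r → ℕ → ℕ) : Prop where
  le : ∀ j i, k j i ≤ lam j i
  ge : ∀ j i, lam j (i + 1) ≤ k j i
  supp : ∀ j i, s ≤ i → k j i = 0
  sum : ∑ i ∈ range s, tildePart k i = ∑ i ∈ range s, mu i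
  dom : ∀ m, m ≤ s → ∑ i ∈ range m, mu i ≤ ∑ i ∈ range m, tildePart k i

theorem split_boxes {r : ℕ} (a b : Fin r → ℕ) (hab : ∀ j, a j ≤ b j) (t : ℕ)
    (h1 : ∑ j, a j ≤ t) (h2 : t ≤ ∑ j, b j) :
    ∃ v : Fin r → ℕ, (∀ j, a j ≤ v j) ∧ (∀ j, v j ≤ b j) ∧ ∑ j, v j = t := by
  induction t, h1 using Nat.le_induction with
  | base => exact ⟨a, fun _ => le_rfl, hab, rfl⟩
  | succ t ht ih =>
    obtain ⟨v, hv1, hv2, hv3⟩ := ih (by omega)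
    have : ∃ j, v j < b j := by
      by_contra! h
      have := Finset.sum_le_sum (fun j (_ : j ∈ Finset.univ) => h j)
      omega
    obtain ⟨j, hj⟩ := this
    refine ⟨Function.update v j (v j + 1), ?_, ?_, ?_⟩
    · intro i
      by_cases h : i = j
      · subst h; simp; have := hv1 i; omega
      · simp [h, hv1 i]
    · intro i
      by_cases h : i = j
      · subst h; simp; omega
      · simp [h, hv2 i]
    · rw [Finset.sum_update_of_mem (Finset.mem_univ j)]
      have := Finset.add_sum_erase Finset.univ v (Finset.mem_univ j)
      rw [← hv3, ← this, Finset.sdiff_singleton_eq_erase]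
      omega

theorem tilde_le {r : ℕ} {k lam : Fin r → ℕ → ℕ} (h : ∀ j i, k j i ≤ lam j i) (i : ℕ) :
    tildePart k i ≤ tildePart lam i := Finset.sum_le_sum (fun j _ => h j i)

theorem tilde_anti {r : ℕ} {lam : Fin r → ℕ → ℕ} (h : ∀ j, Antitone (lam j)) :
    Antitone (tildePart lam) := fun _ _ hab => Finset.sum_le_sum (fun j _ => h j hab)

theorem tilde_zero {r : ℕ} {lam : Fin r → ℕ → ℕ} {i : ℕ} (h : ∀ j, lam j i = 0) :
    tildePart lam i = 0 := Finset.sum_eq_zero (fun j _ => h j)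

/-- termwise `≤` with equal partial sums gives equality -/
theorem eq_of_sum_eq {r : ℕ} {k lam : Fin r → ℕ → ℕ} (h : ∀ j i, k j i ≤ lam j i) (b : ℕ)
    (hs : ∑ i ∈ range b, tildePart lam i ≤ ∑ i ∈ range b, tildePart k i) :
    ∀ i, i < b → ∀ j, k j i = lam j i := by
  intro i hi j
  have h0 := Finset.sum_le_sum (fun i (_ : i ∈ range b) => tilde_le h i)
  have h1 := (Finset.sum_eq_sum_iff_of_le (fun i (_ : i ∈ range b) => tilde_le h i)).1
    (le_antisymm h0 hs) i (by simpa using hi)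
  exact (Finset.sum_eq_sum_iff_of_le (fun j (_ : j ∈ Finset.univ) => h j i)).1 h1 j (by simp)

theorem Feas.anti {r s : ℕ} {lam : Fin r → ℕ → ℕ} {mu : ℕ → ℕ} {k : Fin r → ℕ → ℕ}
    (h : Feas s lam mu k) (j : Fin r) : Antitone (k j) :=
  antitone_nat_of_succ_le (fun i => (h.le j (i+1)).trans (h.ge j i))

/-- The most dominant feasible restriction. -/
theorem exists_kmax {r : ℕ} (s : ℕ) (lam : Fin r → ℕ → ℕ) (mu : ℕ → ℕ)
    (hl : ∀ j, Antitone (lam j)) (hs : ∀ j i, s + 1 ≤ i → lam j i = 0) (hm : Antitone mu)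
    (hsum : ∑ i ∈ range (s+1), tildePart lam i = ∑ i ∈ range (s+1), mu i)
    (hdom : ∀ m, m ≤ s + 1 → ∑ i ∈ range m, mu i ≤ ∑ i ∈ range m, tildePart lam i) :
    ∃ (p : ℕ) (k : Fin r → ℕ → ℕ), Feas s lam mu k ∧ p ≤ s ∧ mu s ≤ tildePart lam p ∧
      (p < s → tildePart lam (p+1) < mu s) ∧
      (∀ j i, i < p → k j i = lam j i) ∧ (∀ j i, p < i → k j i = lam j (i+1)) ∧
      tildePart k p + mu s = tildePart lam p + tildePart lam (p+1) ∧
      (∀ m, m ≤ p → ∑ i ∈ range m, tildePart k i = ∑ i ∈ range m, tildePart lam i) ∧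
      (∀ m, p < m → ∑ i ∈ range m, tildePart k i + mu s
        = ∑ i ∈ range (m+1), tildePart lam i) := by
  have ht := tilde_anti hl
  have h0 : mu s ≤ tildePart lam 0 := by
    have := hdom 1 (by omega)
    simp at this
    exact (hm (Nat.zero_le s)).trans this
  have hms : tildePart lam s ≤ mu s := by
    have := hdom s (by omega)
    rw [Finset.sum_range_succ, Finset.sum_range_succ] at hsum
    omega
  set p := Nat.findGreatest (fun p => mu s ≤ tildePart lam p) s with hp
  have hps : p ≤ s := Nat.findGreatest_le s
  have hp1 : mu s ≤ tildePart lam p :=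
    Nat.findGreatest_spec (P := fun p => mu s ≤ tildePart lam p) (Nat.zero_le s) h0
  have hp2 : p < s → tildePart lam (p+1) < mu s := by
    intro h
    have := Nat.findGreatest_is_greatest (P := fun p => mu s ≤ tildePart lam p)
      (k := p+1) (n := s) (by omega) (by omega)
    omega
  have hp2' : tildePart lam (p+1) ≤ mu s := by
    rcases hps.lt_or_eq with h | h
    · exact (hp2 h).le
    · exact (ht (by omega)).trans hms
  obtain ⟨v, hv1, hv2, hv3⟩ := split_boxes (fun j => lam j (p+1)) (fun j => lam j p)
    (fun j => hl j (by omega)) (tildePart lam p + tildePart lam (p+1) - mu s)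
    (by change tildePart lam (p+1) ≤ _; omega) (by change _ ≤ tildePart lam p; omega)
  set k : Fin r → ℕ → ℕ := fun j i => if i < p then lam j i else if i = p then v j else lam j (i+1)
    with hk
  have k1 : ∀ j i, i < p → k j i = lam j i := by intro j i h; simp [hk, h]
  have k2 : ∀ j i, p < i → k j i = lam j (i+1) := by
    intro j i h; simp [hk, show ¬ i < p by omega, show i ≠ p by omega]
  have k3 : ∀ j, k j p = v j := by intro j; simp [hk]
  have t1 : ∀ i, i < p → tildePart k i = tildePart lam i := by
    intro i h; exact Finset.sum_congr rfl (fun j _ => k1 j i h)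
  have t2 : ∀ i, p < i → tildePart k i = tildePart lam (i+1) := by
    intro i h; exact Finset.sum_congr rfl (fun j _ => k2 j i h)
  have t3 : tildePart k p + mu s = tildePart lam p + tildePart lam (p+1) := by
    have : tildePart k p = ∑ j, v j := Finset.sum_congr rfl (fun j _ => k3 j)
    omega
  have s1 : ∀ m, m ≤ p → ∑ i ∈ range m, tildePart k i = ∑ i ∈ range m, tildePart lam i := by
    intro m h
    apply Finset.sum_congr rfl
    intro i hi
    simp at hi
    exact t1 i (by omega)
  have s2 : ∀ m, p < m → ∑ i ∈ range m, tildePart k i + mu s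
        = ∑ i ∈ range (m+1), tildePart lam i := by
    intro m h
    induction m, h using Nat.le_induction with
    | base =>
      have := s1 p le_rfl
      simp only [Nat.succ_eq_add_one, Finset.sum_range_succ] at *
      omega
    | succ m h ih =>
      rw [Finset.sum_range_succ _ (m+1), Finset.sum_range_succ _ m, t2 m (by omega)]
      omega
  have hks : ∑ i ∈ range s, tildePart k i = ∑ i ∈ range s, mu i := by
    have e : ∑ i ∈ range (s+1), mu i = ∑ i ∈ range s, mu i + mu s := Finset.sum_range_succ _ _
    rcases hps.lt_or_eq with h | h
    · have := s2 s h
      omega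
    · have := s1 s (by omega)
      rw [h] at hp1
      have e' : ∑ i ∈ range (s+1), tildePart lam i = _ := Finset.sum_range_succ _ _
      omega
  refine ⟨p, k, ⟨?_, ?_, ?_, hks, ?_⟩, hps, hp1, hp2, k1, k2, t3, s1, s2⟩
  · intro j i
    rcases lt_trichotomy i p with h | h | h
    · exact (k1 j i h).le
    · rw [h, k3]; exact hv2 j
    · rw [k2 j i h]; exact hl j (by omega)
  · intro j i
    rcases lt_trichotomy i p with h | h | h
    · rw [k1 j i h]; exact hl j (by omega)
    · rw [h, k3]; exact hv1 j
    · rw [k2 j i h]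
  · intro j i hi
    rcases lt_trichotomy i p with h | h | h
    · omega
    · have : p = s := by omega
      have e2 : tildePart lam (p+1) = 0 := tilde_zero (fun j => hs j _ (by omega))
      have e3 : tildePart k p = 0 := by
        have e4 : tildePart lam p ≤ mu s := by rw [this]; exact hms
        omega
      rw [h]
      exact (Finset.sum_eq_zero_iff.1 e3) j (by simp)
    · rw [k2 j i h]; exact hs j _ (by omega)
  · intro m hmle
    rcases le_or_gt m p with h | h
    · rw [s1 m h]; exact hdom m (by omega)
    · have a1 := s2 m h
      have a2 := hdom (m+1) (by omega)
      have a3 := hm hmle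
      rw [Finset.sum_range_succ] at a2
      omega

theorem Pat.extend {r s : ℕ} {lam k : Fin r → ℕ → ℕ} {mu : ℕ → ℕ}
    {c : ℕ → Fin r → ℕ → ℕ} (hl : ∀ j, Antitone (lam j))
    (hsum : ∑ i ∈ range (s+1), tildePart lam i = ∑ i ∈ range (s+1), mu i)
    (hk : Feas s lam mu k) (hc : Pat s k mu c) :
    Pat (s+1) lam mu (fun m => if m ≤ s then c m else lam) := by
  have hcs : c s = k := hc.top s le_rfl
  refine ⟨?_, ?_, ?_, ?_, ?_⟩
  · intro j i; simp [hc.zero]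
  · intro m hm; simp [show ¬ m ≤ s by omega]
  · intro m j i
    rcases lt_trichotomy m s with h | h | h
    · simp [h.le, show m + 1 ≤ s by omega, hc.mono]
    · subst h; simp [hcs, hk.le]
    · simp [show ¬ m ≤ s by omega, show ¬ m + 1 ≤ s by omega]
  · intro m j i
    rcases lt_trichotomy m s with h | h | h
    · simp [h.le, show m + 1 ≤ s by omega, hc.diag]
    · subst h; simp [hcs, hk.ge]
    · simp [show ¬ m ≤ s by omega, show ¬ m + 1 ≤ s by omega]; exact hl j (by omega)
  · intro m hm
    rcases Nat.lt_or_ge s m with h | h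
    · have : m = s + 1 := by omega
      subst this; simpa using hsum
    · simp [h]; exact hc.sum m h

theorem exists_pat {r : ℕ} (mu : ℕ → ℕ) (hm : Antitone mu) (s : ℕ) :
    ∀ (lam : Fin r → ℕ → ℕ)
    (_ : ∀ j, Antitone (lam j)) (_ : ∀ j i, s ≤ i → lam j i = 0)
    (_ : ∑ i ∈ range s, tildePart lam i = ∑ i ∈ range s, mu i)
    (_ : ∀ m, m ≤ s → ∑ i ∈ range m, mu i ≤ ∑ i ∈ range m, tildePart lam i),
    ∃ c, Pat s lam mu c := by
  induction s with
  | zero =>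
    intro lam hl hs hsum hdom
    refine ⟨fun _ => lam, fun j i => hs j i (by omega), fun _ _ => rfl, fun _ _ _ => le_rfl,
      fun _ j i => hl j (by omega), ?_⟩
    intro m h
    have : m = 0 := by omega
    subst this; simp
  | succ s ih =>
    intro lam hl hs hsum hdom
    obtain ⟨p, k, hk, -⟩ := exists_kmax s lam mu hl hs hm hsum hdom
    obtain ⟨c, hc⟩ := ih k hk.anti hk.supp hk.sum hk.dom
    exact ⟨_, hc.extend hl hsum hk⟩

theorem Feas.move {r s : ℕ} {lam k : Fin r → ℕ → ℕ} {mu : ℕ → ℕ} (hk : Feas s lam mu k)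
    (j j' : Fin r) (i i' : ℕ) (hii : i ≤ i') (his : i' < s)
    (h1 : lam j (i+1) < k j i) (h2 : k j' i' < lam j' i')
    (hst : ∀ m, i < m → m ≤ i' → ∑ x ∈ range m, mu x < ∑ x ∈ range m, tildePart k x)
    (hne : ¬ (j = j' ∧ i = i')) : ∃ k', Feas s lam mu k' ∧ k' ≠ k := by
  classical
  set k' : Fin r → ℕ → ℕ := fun a b =>
    if a = j ∧ b = i then k a b - 1 else if a = j' ∧ b = i' then k a b + 1 else k a b with hk'
  have key : ∀ a b, k' a b + (if a = j ∧ b = i then 1 else 0)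
      = k a b + (if a = j' ∧ b = i' then 1 else 0) := by
    intro a b
    simp only [hk']
    by_cases c1 : a = j ∧ b = i
    · have : ¬ (a = j' ∧ b = i') := by
        rintro ⟨e1, e2⟩
        exact hne ⟨c1.1.symm.trans e1, c1.2.symm.trans e2⟩
      have : 0 < k a b := by rw [c1.1, c1.2]; omega
      simp only [c1, and_self, if_true] at *
      simp [*]
      omega
    · by_cases c2 : a = j' ∧ b = i'
      · rw [if_neg c1, if_pos c2, if_neg c1, if_pos c2]
      · simp [c1, c2]
  have keyt : ∀ b, tildePart k' b + (if b = i then 1 else 0)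
      = tildePart k b + (if b = i' then 1 else 0) := by
    intro b
    have := Finset.sum_congr rfl (fun a (_ : a ∈ (Finset.univ : Finset (Fin r))) => key a b)
    rw [Finset.sum_add_distrib, Finset.sum_add_distrib] at this
    have e : ∀ (j : Fin r) (i : ℕ), ∑ a : Fin r, (if a = j ∧ b = i then 1 else 0)
        = if b = i then 1 else 0 := by
      intro j i
      by_cases hb : b = i <;> simp [hb]
    rw [e, e] at this
    exact this
  have keys : ∀ m, ∑ x ∈ range m, tildePart k' x + (if i < m then 1 else 0)
      = ∑ x ∈ range m, tildePart k x + (if i' < m then 1 else 0) := by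
    intro m
    have := Finset.sum_congr rfl (fun a (_ : a ∈ range m) => keyt a)
    rw [Finset.sum_add_distrib, Finset.sum_add_distrib] at this
    simpa using this
  refine ⟨k', ⟨?_, ?_, ?_, ?_, ?_⟩, ?_⟩
  · intro a b
    have e := key a b
    have := hk.le a b
    by_cases c2 : a = j' ∧ b = i'
    · obtain ⟨rfl, rfl⟩ := c2
      simp at e
      split_ifs at e <;> omega
    · simp only [c2, if_false] at e
      omega
  · intro a b
    have e := key a b
    have := hk.ge a b
    by_cases c2 : a = j ∧ b = i
    · obtain ⟨rfl, rfl⟩ := c2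
      simp at e
      split_ifs at e <;> omega
    · simp only [c2, if_false] at e
      omega
  · intro a b hb
    have := hk.supp a b hb
    simp [hk', this, show b ≠ i' by omega]
  · have := keys s
    simp only [show i < s by omega, his, if_true] at this
    have := hk.sum
    omega
  · intro m hm
    have e := keys m
    have a1 := hk.dom m hm
    have a2 := hst m
    split_ifs at e <;> omega
  · intro e
    have := key j i
    rw [e] at this
    simp at this
    exact hne this

theorem main_forward {r : ℕ} (mu : ℕ → ℕ) (hm : Antitone mu) (s : ℕ) :
    ∀ (lam : Fin r → ℕ → ℕ)
    (_ : ∀ j, Antitone (lam j)) (_ : ∀ j i, s ≤ i → lam j i = 0)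
    (_ : ∑ i ∈ range s, tildePart lam i = ∑ i ∈ range s, mu i)
    (_ : ∀ m, m ≤ s → ∑ i ∈ range m, mu i ≤ ∑ i ∈ range m, tildePart lam i)
    (_ : ∀ c c', Pat s lam mu c → Pat s lam mu c' → c = c')
    (a b : ℕ) (_ : a < b) (_ : b ≤ s)
    (_ : ∑ i ∈ range a, tildePart lam i = ∑ i ∈ range a, mu i)
    (_ : ∑ i ∈ range b, tildePart lam i = ∑ i ∈ range b, mu i)
    (_ : ∀ m, a < m → m < b → ∑ i ∈ range m, mu i < ∑ i ∈ range m, tildePart lam i),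
    Good lam a b := by
  induction s with
  | zero => intros; omega
  | succ s ih =>
    intro lam hl hs hsum hdom hU a b hab hbs hta htb hst
    have ht := tilde_anti hl
    -- uniqueness of the feasible restriction
    have hUF : ∀ k k', Feas s lam mu k → Feas s lam mu k' → k = k' := by
      intro k k' hk hk'
      obtain ⟨c, hc⟩ := exists_pat mu hm s k hk.anti hk.supp hk.sum hk.dom
      obtain ⟨c', hc'⟩ := exists_pat mu hm s k' hk'.anti hk'.supp hk'.sum hk'.dom
      have := hU _ _ (hc.extend hl hsum hk) (hc'.extend hl hsum hk')
      have := congrFun this s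
      simp only [le_refl, if_true] at this
      rwa [hc.top s le_rfl, hc'.top s le_rfl] at this
    have hUk : ∀ k, Feas s lam mu k → ∀ c c', Pat s k mu c → Pat s k mu c' → c = c' := by
      intro k hk c c' hc hc'
      have := hU _ _ (hc.extend hl hsum hk) (hc'.extend hl hsum hk)
      funext m
      rcases Nat.lt_or_ge s m with h | h
      · rw [hc.top m h.le, hc'.top m h.le]
      · have := congrFun this m
        simpa [h] using this
    obtain ⟨p, k, hk, hps, hp1, hp2, k1, k2, t3, s1, s2⟩ :=
      exists_kmax s lam mu hl hs hm hsum hdom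
    have tight : ∀ x, x ≤ s → ∑ i ∈ range x, tildePart lam i = ∑ i ∈ range x, mu i →
        ∀ i, i < x → ∀ j, k j i = lam j i := by
      intro x hx hxt
      exact eq_of_sum_eq hk.le x (by rw [hxt]; exact hk.dom x hx)
    have tights : ∀ x, x ≤ s → ∑ i ∈ range x, tildePart lam i = ∑ i ∈ range x, mu i →
        ∀ y, y ≤ x → ∑ i ∈ range y, tildePart k i = ∑ i ∈ range y, tildePart lam i := by
      intro x hx hxt y hy
      apply Finset.sum_congr rfl
      intro i hi
      simp at hi
      exact Finset.sum_congr rfl (fun j _ => tight x hx hxt i (by omega) j)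
    rcases Nat.lt_or_ge s b with hb | hb
    swap
    · -- the block is not the last one
      have hG := ih k hk.anti hk.supp hk.sum hk.dom (hUk k hk) a b hab hb
        (by rw [tights b hb htb a hab.le, hta]) (by rw [tights b hb htb b le_rfl, htb])
        (fun m h1 h2 => by rw [tights b hb htb m h2.le]; exact hst m h1 h2)
      have e := tight b hb htb
      refine ⟨fun j j' hj hj' => hG.1 j j' (fun h => hj ?_) (fun h => hj' ?_), fun j => ?_⟩
      · intro x y h1 h2 h3
        rw [← e x (by omega), ← e y (by omega)]; exact h x y h1 h2 h3
      · intro x y h1 h2 h3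
        rw [← e x (by omega), ← e y (by omega)]; exact h x y h1 h2 h3
      · rcases hG.2 j with h | ⟨h0, h⟩ | ⟨h0, h⟩
        · left
          intro x y h1 h2 h3
          rw [← e x (by omega), ← e y (by omega)]; exact h x y h1 h2 h3
        · right; left
          refine ⟨by rw [← e _ (by omega), ← e a (by omega)]; exact h0, ?_⟩
          intro x y h1 h2 h3
          rw [← e x (by omega), ← e y (by omega)]; exact h x y h1 h2 h3
        · rcases Nat.lt_or_ge (a+1) b with h' | h'
          · right; right
            refine ⟨by rw [← e _ (by omega), ← e a (by omega)]; exact h0, ?_⟩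
            intro x y h1 h2 h3
            rw [← e x (by omega), ← e y (by omega)]; exact h x y h1 h2 h3
          · left
            intro x y h1 h2 h3
            have : x = y := by omega
            rw [this]
    · have hbe : b = s + 1 := by omega
      subst hbe
      rcases Nat.lt_or_ge a s with has | has
      swap
      · have triv : ∀ j, ∀ x y, a ≤ x → x ≤ y → y < s + 1 → lam j x = lam j y := by
          intro j x y h1 h2 h3
          have : x = y := by omega
          rw [this]
        exact ⟨fun j j' hj _ => absurd (triv j) hj, fun j => Or.inl (triv j)⟩
      have hmus : tildePart lam s < mu s := by
        have := hst s has (by omega)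
        rw [Finset.sum_range_succ, Finset.sum_range_succ] at hsum
        omega
      have hpls : p < s := by
        rcases hps.lt_or_eq with h | h
        · exact h
        · rw [h] at hp1; omega
      have hp2 := hp2 hpls
      have hkp : tildePart k p < tildePart lam p := by omega
      have hap : a ≤ p := by
        by_contra! h
        have : tildePart k p = tildePart lam p :=
          Finset.sum_congr rfl (fun j _ => tight a has.le hta p h j)
        omega
      have hkst : ∀ m, a < m → m < s → ∑ i ∈ range m, mu i < ∑ i ∈ range m, tildePart k i := by
        intro m h1 h2
        rcases le_or_gt m p with h | h
        · rw [s1 m h]; exact hst m h1 (by omega)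
        · have a1 := s2 m h
          have a2 := hst (m+1) (by omega) (by omega)
          have a3 := hm h2.le
          rw [Finset.sum_range_succ] at a2
          omega
      have hG := ih k hk.anti hk.supp hk.sum hk.dom (hUk k hk) a s has le_rfl
        (by rw [tights a has.le hta a le_rfl, hta]) hk.sum hkst
      have nomove : ∀ j j' i i', a ≤ i → i ≤ i' → i' < s → lam j (i+1) < k j i →
          k j' i' < lam j' i' → j = j' ∧ i = i' := by
        intro j j' i i' h1 h2 h3 h4 h5
        by_contra hne
        obtain ⟨k', hk', hne'⟩ := hk.move j j' i i' h2 h3 h4 h5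
          (fun m h6 h7 => hkst m (by omega) (by omega)) hne
        exact hne' (hUF _ _ hk' hk)
      obtain ⟨j0, hj0⟩ : ∃ j, k j p < lam j p := by
        by_contra! h
        have : tildePart lam p ≤ tildePart k p := Finset.sum_le_sum (fun j _ => h j)
        omega
      have hc1 : ∀ j i, a ≤ i → i < p → lam j (i+1) = lam j i := by
        intro j i h1 h2
        by_contra hne
        have := nomove j j0 i p h1 h2.le hpls
          (by rw [k1 j i h2]; exact lt_of_le_of_ne (hl j (by omega)) hne) hj0
        omega
      have hc1' : ∀ j i, a ≤ i → i ≤ p → lam j i = lam j a := by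
        intro j i h1
        induction i, h1 using Nat.le_induction with
        | base => intro _; rfl
        | succ i h1 ih' => intro h2; rw [hc1 j i h1 (by omega), ih' (by omega)]
      have hlt : tildePart lam (p+1) < tildePart k p := by
        by_contra! h
        have hmeq : mu s = tildePart lam p := by omega
        have hap' : tildePart lam a = tildePart lam p :=
          Finset.sum_congr rfl (fun j _ => (hc1' j p hap le_rfl).symm)
        have hle : ∀ i ∈ Finset.Ico a (s+1), tildePart lam i ≤ mu i := by
          intro i hi
          rw [Finset.mem_Ico] at hi
          have b1 := ht hi.1
          have b2 := hm (show i ≤ s by omega)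
          omega
        have := Finset.sum_lt_sum hle ⟨p+1, by rw [Finset.mem_Ico]; omega, by
          have b2 := hm (show p + 1 ≤ s by omega)
          omega⟩
        have e1 := Finset.sum_range_add_sum_Ico (tildePart lam) hab.le
        have e2 := Finset.sum_range_add_sum_Ico mu hab.le
        omega
      obtain ⟨j1, hj1⟩ : ∃ j, lam j (p+1) < k j p := by
        by_contra! h
        have : tildePart k p ≤ tildePart lam (p+1) := Finset.sum_le_sum (fun j _ => h j)
        omega
      have hj10 := (nomove j1 j0 p p hap le_rfl hpls hj1 hj0).1
      subst hj10
      have hc2 : ∀ j i, p < i → i < s → lam j (i+1) = lam j i := by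
        intro j i h1 h2
        by_contra hne
        have := nomove j1 j p i hap h1.le h2 hj1
          (by rw [k2 j i h1]; exact lt_of_le_of_ne (hl j (by omega)) hne)
        omega
      have hc2' : ∀ j i, p < i → i ≤ s → lam j i = lam j (p+1) := by
        intro j i h1
        induction i, h1 using Nat.le_induction with
        | base => intro _; rfl
        | succ i h1 ih' => intro h2; rw [hc2 j i h1 (by omega), ih' (by omega)]
      have hc3 : ∀ j, j ≠ j1 → lam j (p+1) = lam j p := by
        intro j hne
        have b1 := hk.le j p
        have b2 := hk.ge j p
        by_contra hne'
        rcases Nat.lt_or_ge (lam j (p+1)) (k j p) with h | h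
        · exact hne (nomove j j1 p p hap le_rfl hpls h hj0).1
        · exact hne (nomove j1 j p p hap le_rfl hpls hj1 (by omega)).1.symm
      have hconst : ∀ j, j ≠ j1 → ∀ i, a ≤ i → i < s + 1 → lam j i = lam j a := by
        intro j hne i h1 h2
        rcases le_or_gt i p with h | h
        · exact hc1' j i h1 h
        · rw [hc2' j i h (by omega), hc3 j hne, hc1' j p hap le_rfl]
      have hconst' : ∀ j, j ≠ j1 → ∀ x y, a ≤ x → x ≤ y → y < s + 1 → lam j x = lam j y := by
        intro j hne x y h1 h2 h3
        rw [hconst j hne x h1 (by omega), hconst j hne y (by omega) h3]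
      have hends : p = a ∨ p + 1 = s := by
        by_contra! h
        have e1 : k j1 (p-1) = lam j1 p := by
          rw [k1 j1 (p-1) (by omega), hc1' j1 p hap le_rfl, hc1' j1 (p-1) (by omega) (by omega)]
        have e2 : k j1 (p+1) = lam j1 (p+1) := by
          rw [k2 j1 (p+1) (by omega), hc2' j1 (p+1+1) (by omega) (by omega)]
        rcases hG.2 j1 with h' | ⟨-, h'⟩ | ⟨-, h'⟩
        · have := h' p (p+1) (by omega) (by omega) (by omega)
          omega
        · have := h' (p-1) p (by omega) (by omega) (by omega)
          omega
        · have := h' p (p+1) (by omega) (by omega) (by omega)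
          omega
      refine ⟨fun j j' hj hj' => ?_, fun j => ?_⟩
      · have e1 : j = j1 := by
          by_contra hne; exact hj (hconst' j hne)
        have e2 : j' = j1 := by
          by_contra hne; exact hj' (hconst' j' hne)
        rw [e1, e2]
      · by_cases hne : j = j1
        swap
        · exact Or.inl (hconst' j hne)
        subst hne
        rcases hends with h | h
        · right; right
          subst h
          refine ⟨by omega, ?_⟩
          intro x y h1 h2 h3
          rw [hc2' j x (by omega) (by omega), hc2' j y (by omega) (by omega)]
        · right; left
          subst h
          refine ⟨?_, ?_⟩
          · have := hc1' j p hap le_rfl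
            simp
            omega
          · intro x y h1 h2 h3
            rw [hc1' j x (by omega) (by omega), hc1' j y (by omega) (by omega)]

theorem Pat.le_of_le {r s : ℕ} {lam : Fin r → ℕ → ℕ} {mu : ℕ → ℕ}
    {c : ℕ → Fin r → ℕ → ℕ} (hc : Pat s lam mu c) {m m' : ℕ} (h : m ≤ m') (j : Fin r) (i : ℕ) :
    c m j i ≤ c m' j i := by
  induction m', h using Nat.le_induction with
  | base => exact le_rfl
  | succ n h ih => exact ih.trans (hc.mono n j i)

theorem Pat.le_lam {r s : ℕ} {lam : Fin r → ℕ → ℕ} {mu : ℕ → ℕ}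
    {c : ℕ → Fin r → ℕ → ℕ} (hc : Pat s lam mu c) (m : ℕ) (j : Fin r) (i : ℕ) :
    c m j i ≤ lam j i := by
  have := hc.le_of_le (le_max_left m s) j i
  rwa [hc.top _ (le_max_right m s)] at this

theorem Pat.diag' {r s : ℕ} {lam : Fin r → ℕ → ℕ} {mu : ℕ → ℕ}
    {c : ℕ → Fin r → ℕ → ℕ} (hc : Pat s lam mu c) (m d : ℕ) (j : Fin r) (i : ℕ) :
    c (m + d) j (i + d) ≤ c m j i := by
  induction d with
  | zero => exact le_rfl
  | succ n ih => exact (hc.diag (m+n) j (i+n)).trans ih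

theorem Pat.supp {r s : ℕ} {lam : Fin r → ℕ → ℕ} {mu : ℕ → ℕ}
    {c : ℕ → Fin r → ℕ → ℕ} (hc : Pat s lam mu c) (m : ℕ) (j : Fin r) (i : ℕ) (h : m ≤ i) :
    c m j i = 0 := by
  have := hc.diag' 0 m j (i - m)
  rw [hc.zero, Nat.zero_add, Nat.sub_add_cancel h] at this
  omega

theorem Pat.dom {r s : ℕ} {lam : Fin r → ℕ → ℕ} {mu : ℕ → ℕ}
    {c : ℕ → Fin r → ℕ → ℕ} (hc : Pat s lam mu c) (m : ℕ) (h : m ≤ s) :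
    ∑ i ∈ range m, mu i ≤ ∑ i ∈ range m, tildePart lam i := by
  rw [← hc.sum m h]
  exact Finset.sum_le_sum (fun i _ => tilde_le (hc.le_lam m) i)

theorem Pat.tight {r s : ℕ} {lam : Fin r → ℕ → ℕ} {mu : ℕ → ℕ}
    {c : ℕ → Fin r → ℕ → ℕ} (hc : Pat s lam mu c) (m : ℕ) (h : m ≤ s)
    (ht : ∑ i ∈ range m, tildePart lam i = ∑ i ∈ range m, mu i) (i : ℕ) (hi : i < m)
    (j : Fin r) : c m j i = lam j i :=
  eq_of_sum_eq (hc.le_lam m) m (by rw [ht, hc.sum m h]) i hi j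

/-- The (at most one) free position of row family `j` in the block `[a, b)` at level `m`. -/
theorem free_pos {r : ℕ} {lam : Fin r → ℕ → ℕ} {a b : ℕ} (hG : Good lam a b) (m : ℕ)
    (hmb : m ≤ b) (j : Fin r) :
    ∃ i0, i0 = i0 ∧ ∀ i, a ≤ i → i < m → i ≠ i0 → lam j i = lam j (i + (b - m)) := by
  rcases hG.2 j with h | ⟨-, h⟩ | ⟨-, h⟩
  · exact ⟨0, rfl, fun i h1 h2 _ => h i _ h1 (by omega) (by omega)⟩
  · exact ⟨m - 1, rfl, fun i h1 h2 _ => h i _ h1 (by omega) (by omega)⟩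
  · exact ⟨a, rfl, fun i h1 h2 _ => h i _ (by omega) (by omega) (by omega)⟩

theorem pat_block_unique {r s : ℕ} {lam : Fin r → ℕ → ℕ} {mu : ℕ → ℕ}
    {c c' : ℕ → Fin r → ℕ → ℕ} (hc : Pat s lam mu c) (hc' : Pat s lam mu c') (a b : ℕ)
    (hbs : b ≤ s)
    (hta : ∑ i ∈ range a, tildePart lam i = ∑ i ∈ range a, mu i)
    (htb : ∑ i ∈ range b, tildePart lam i = ∑ i ∈ range b, mu i)
    (hG : Good lam a b) (m : ℕ) (ham : a ≤ m) (hmb : m ≤ b) : c m = c' m := by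
  classical
  have low : ∀ {c : ℕ → Fin r → ℕ → ℕ}, Pat s lam mu c → ∀ j i, i < a → c m j i = lam j i := by
    intro c hc j i hi
    have h1 := hc.tight a (by omega) hta i hi j
    have h2 := hc.le_of_le ham j i
    have h3 := hc.le_lam m j i
    omega
  have mid : ∀ {c : ℕ → Fin r → ℕ → ℕ}, Pat s lam mu c → ∀ j i, i < m →
      lam j i = lam j (i + (b - m)) → c m j i = lam j i := by
    intro c hc j i hi he
    have h1 := hc.tight b hbs htb (i + (b - m)) (by omega) j
    have h2 := hc.diag' m (b - m) j i
    rw [Nat.add_sub_cancel' hmb] at h2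
    have h3 := hc.le_lam m j i
    omega
  have agree : ∀ j i, (i < m → a ≤ i → lam j i = lam j (i + (b - m))) → c m j i = c' m j i := by
    intro j i h
    rcases Nat.lt_or_ge i m with h1 | h1
    · rcases Nat.lt_or_ge i a with h2 | h2
      · rw [low hc j i h2, low hc' j i h2]
      · rw [mid hc j i h1 (h h1 h2), mid hc' j i h1 (h h1 h2)]
    · rw [hc.supp m j i h1, hc'.supp m j i h1]
  have sums : ∑ i ∈ range m, tildePart (c m) i = ∑ i ∈ range m, tildePart (c' m) i := by
    rw [hc.sum m (by omega), hc'.sum m (by omega)]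
  by_cases hall : ∀ j, ∀ x y, a ≤ x → x ≤ y → y < b → lam j x = lam j y
  · funext j i
    exact agree j i (fun h1 h2 => hall j i _ h2 (by omega) (by omega))
  · obtain ⟨j0, hj0⟩ := not_forall.1 hall
    have hoth : ∀ j, j ≠ j0 → ∀ i, c m j i = c' m j i := by
      intro j hj i
      have : ∀ x y, a ≤ x → x ≤ y → y < b → lam j x = lam j y := by
        by_contra h
        exact hj (hG.1 j j0 h hj0)
      exact agree j i (fun h1 h2 => this i _ h2 (by omega) (by omega))
    obtain ⟨i0, -, hi0⟩ := free_pos hG m hmb j0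
    have hoth2 : ∀ i, i ≠ i0 → c m j0 i = c' m j0 i := fun i hi =>
      agree j0 i (fun h1 h2 => hi0 i h2 h1 hi)
    have hlast : c m j0 i0 = c' m j0 i0 := by
      rcases Nat.lt_or_ge i0 m with h | h
      · have e1 : ∑ i ∈ (range m).erase i0, tildePart (c m) i
            = ∑ i ∈ (range m).erase i0, tildePart (c' m) i := by
          apply Finset.sum_congr rfl
          intro i hi
          apply Finset.sum_congr rfl
          intro j _
          by_cases hj : j = j0
          · subst hj; exact hoth2 i (Finset.ne_of_mem_erase hi)
          · exact hoth j hj i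
        rw [← Finset.add_sum_erase _ _ (Finset.mem_range.2 h),
          ← Finset.add_sum_erase _ _ (Finset.mem_range.2 h), e1] at sums
        have e2 : tildePart (c m) i0 = tildePart (c' m) i0 := by omega
        have e3 : ∑ j ∈ (Finset.univ : Finset (Fin r)).erase j0, c m j i0
            = ∑ j ∈ (Finset.univ : Finset (Fin r)).erase j0, c' m j i0 :=
          Finset.sum_congr rfl (fun j hj => hoth j (Finset.ne_of_mem_erase hj) i0)
        unfold tildePart at e2
        rw [← Finset.add_sum_erase _ _ (Finset.mem_univ j0),
          ← Finset.add_sum_erase _ _ (Finset.mem_univ j0), e3] at e2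
        omega
      · rw [hc.supp m j0 i0 h, hc'.supp m j0 i0 h]
    funext j i
    by_cases hj : j = j0
    · subst hj
      by_cases hi : i = i0
      · subst hi; exact hlast
      · exact hoth2 i hi
    · exact hoth j hj i

theorem build_blocks (Q : ℕ → ℕ → Prop) (t0 : ℕ → Prop) (l : ℕ)
    (h : ∀ b, b ≤ l → t0 b → 0 < b → ∃ a, a < b ∧ t0 a ∧ Q a b) :
    ∀ b, b ≤ l → t0 b → ∃ (t : ℕ) (f : ℕ → ℕ), f 0 = 0 ∧ f t = b ∧
      (∀ k, k < t → f k < f (k+1)) ∧ ∀ k, k < t → Q (f k) (f (k+1)) := by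
  intro b
  induction b using Nat.strong_induction_on with
  | _ b ih =>
    intro hb ht
    rcases Nat.eq_zero_or_pos b with h0 | h0
    · exact ⟨0, fun _ => 0, rfl, h0.symm, by simp, by simp⟩
    · obtain ⟨a, hab, hta, hQ⟩ := h b hb ht h0
      obtain ⟨t, f, f0, ft, f1, f2⟩ := ih a hab (by omega) hta
      refine ⟨t+1, fun k => if k ≤ t then f k else b, by simp [f0], by simp, ?_, ?_⟩
      · intro k hk
        rcases Nat.lt_or_ge k t with h | h
        · simp [h.le, show k + 1 ≤ t by omega, f1 k h]
        · have : k = t := by omega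
          subst this; simp [ft, hab]
      · intro k hk
        rcases Nat.lt_or_ge k t with h | h
        · simp [h.le, show k + 1 ≤ t by omega, f2 k h]
        · have : k = t := by omega
          subst this; simp [ft, hQ]

theorem exists_prev_tight (t0 : ℕ → Prop) (h0 : t0 0) (b : ℕ) (hb : 0 < b) :
    ∃ a, a < b ∧ t0 a ∧ ∀ m, a < m → m < b → ¬ t0 m := by
  classical
  refine ⟨Nat.findGreatest t0 (b-1), ?_, Nat.findGreatest_spec (Nat.zero_le _) h0, ?_⟩
  · have := Nat.findGreatest_le (P := t0) (b-1)
    omega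
  · intro m h1 h2
    exact Nat.findGreatest_is_greatest h1 (by omega)

/-- The block condition. -/
def BlockCond {r : ℕ} (lam : Fin r → ℕ → ℕ) (mu : ℕ → ℕ) (a b : ℕ) : Prop :=
  ((∑ i ∈ Finset.Ico a b, tildePart lam i = ∑ i ∈ Finset.Ico a b, mu i) ∧
    (∀ m, a ≤ m → m ≤ b →
      ∑ i ∈ Finset.Ico a m, mu i ≤ ∑ i ∈ Finset.Ico a m, tildePart lam i)) ∧ Good lam a b

/-- The core theorem on patterns. -/
theorem core {r l : ℕ} (lam : Fin r → ℕ → ℕ) (mu : ℕ → ℕ)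
    (hl : ∀ j, Antitone (lam j)) (hm : Antitone mu)
    (hfull : ∑ i ∈ range l, tildePart lam i = ∑ i ∈ range l, mu i → ∀ j i, l ≤ i → lam j i = 0) :
    (∃ c, Pat l lam mu c ∧ ∀ c', Pat l lam mu c' → c' = c) ↔
    ∃ (t : ℕ) (f : ℕ → ℕ), f 0 = 0 ∧ f t = l ∧ (∀ k, k < t → f k < f (k + 1)) ∧
        ∀ k, k < t → BlockCond lam mu (f k) (f (k+1)) := by
  constructor
  · rintro ⟨c, hc, hu⟩
    have hsum : ∑ i ∈ range l, tildePart lam i = ∑ i ∈ range l, mu i := by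
      rw [← hc.sum l le_rfl, hc.top l le_rfl]
    refine build_blocks (BlockCond lam mu)
      (fun m => ∑ i ∈ range m, tildePart lam i = ∑ i ∈ range m, mu i) l ?_ l le_rfl hsum
    intro b hb htb h0
    obtain ⟨a, hab, hta, hno⟩ := exists_prev_tight
      (fun m => ∑ i ∈ range m, tildePart lam i = ∑ i ∈ range m, mu i) (by simp) b h0
    have hdom := hc.dom
    refine ⟨a, hab, hta, ⟨?_, ?_⟩, ?_⟩
    · have e1 := Finset.sum_range_add_sum_Ico (tildePart lam) hab.le
      have e2 := Finset.sum_range_add_sum_Ico mu hab.le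
      omega
    · intro m h1 h2
      have e1 := Finset.sum_range_add_sum_Ico (tildePart lam) h1
      have e2 := Finset.sum_range_add_sum_Ico mu h1
      have := hdom m (by omega)
      omega
    · exact main_forward mu hm l lam hl (hfull hsum) hsum hdom
        (fun c c' h h' => (hu c h).trans (hu c' h').symm) a b hab hb hta htb
        (fun m h1 h2 => lt_of_le_of_ne (hdom m (by omega)) (fun e => hno m h1 h2 e.symm))
  · rintro ⟨t, f, f0, ft, f1, f2⟩
    have mono : ∀ k k', k ≤ k' → k' ≤ t → f k ≤ f k' := by
      intro k k' h
      induction k', h using Nat.le_induction with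
      | base => intro _; exact le_rfl
      | succ n h ih => intro h'; exact (ih (by omega)).trans (f1 n (by omega)).le
    have step : ∀ k, k ≤ t → ∑ i ∈ range (f k), tildePart lam i = ∑ i ∈ range (f k), mu i ∧
        ∀ m, m ≤ f k → ∑ i ∈ range m, mu i ≤ ∑ i ∈ range m, tildePart lam i := by
      intro k
      induction k with
      | zero =>
        intro _
        rw [f0]
        refine ⟨by simp, fun m h => ?_⟩
        have : m = 0 := by omega
        simp [this]
      | succ k ih =>
        intro hk
        obtain ⟨g1, g2⟩ := ih (by omega)
        have hlt := f1 k (by omega)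
        obtain ⟨⟨b1, b2⟩, -⟩ := f2 k (by omega)
        constructor
        · have e1 := Finset.sum_range_add_sum_Ico (tildePart lam) hlt.le
          have e2 := Finset.sum_range_add_sum_Ico mu hlt.le
          omega
        · intro m hm
          rcases le_or_gt m (f k) with h | h
          · exact g2 m h
          · have e1 := Finset.sum_range_add_sum_Ico (tildePart lam) h.le
            have e2 := Finset.sum_range_add_sum_Ico mu h.le
            have := b2 m h.le hm
            omega
    obtain ⟨hsum, hdom⟩ := step t le_rfl
    rw [ft] at hsum hdom
    obtain ⟨c, hc⟩ := exists_pat mu hm l lam hl (hfull hsum) hsum hdom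
    refine ⟨c, hc, fun c' hc' => ?_⟩
    have levels : ∀ k, k ≤ t → ∀ m, m ≤ f k → c' m = c m := by
      intro k
      induction k with
      | zero =>
        intro _ m hm
        have : m = 0 := by omega
        subst this
        funext j i
        rw [hc.zero, hc'.zero]
      | succ k ih =>
        intro hk m hm
        rcases le_or_gt m (f k) with h | h
        · exact ih (by omega) m h
        · exact pat_block_unique hc' hc (f k) (f (k+1)) (by rw [← ft]; exact mono _ _ hk le_rfl)
            (step k (by omega)).1 (step (k+1) hk).1 (f2 k (by omega)).2 m h.le hm
    funext m
    rcases le_or_gt m l with h | h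
    · exact levels t le_rfl m (by omega)
    · rw [hc.top m h.le, hc'.top m h.le]

/-- Pattern of a multitableau. -/
def toC {r : ℕ} (lam : Fin r → ℕ → ℕ) (T : Fin r → ℕ → ℕ → ℕ) : ℕ → Fin r → ℕ → ℕ :=
  fun m j i => ((range (lam j i)).filter (fun t => T j i t ≤ m)).card

/-- Multitableau of a pattern. -/
noncomputable def toT {r : ℕ} (lam : Fin r → ℕ → ℕ) (c : ℕ → Fin r → ℕ → ℕ) :
    Fin r → ℕ → ℕ → ℕ :=
  fun j i t => if t < lam j i then sInf {m | t < c m j i} else 0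

/-- The correspondence between tableaux and patterns. -/
def TabRel {r : ℕ} (lam : Fin r → ℕ → ℕ) (T : Fin r → ℕ → ℕ → ℕ) (c : ℕ → Fin r → ℕ → ℕ) : Prop :=
  ∀ m j i t, t < c m j i ↔ t < lam j i ∧ T j i t ≤ m

theorem lower_card (A : Finset ℕ) (h : ∀ x ∈ A, ∀ y, y ≤ x → y ∈ A) (t : ℕ) :
    t < A.card ↔ t ∈ A := by
  constructor
  · intro ht
    by_contra hn
    have : A ⊆ range t := by
      intro x hx
      rw [Finset.mem_range]
      by_contra! h'
      exact hn (h x hx t h')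
    have := Finset.card_le_card this
    simp at this
    omega
  · intro ht
    have : range (t+1) ⊆ A := by
      intro x hx
      exact h t ht x (by simp at hx; omega)
    have := Finset.card_le_card this
    simp at this
    omega

theorem rel_toC {r : ℕ} {lam : Fin r → ℕ → ℕ} {T : Fin r → ℕ → ℕ → ℕ}
    (hT : ∀ j, IsSSYT (lam j) (T j)) : TabRel lam T (toC lam T) := by
  intro m j i t
  unfold toC
  rw [lower_card]
  · simp
  · intro x hx y hy
    simp at hx ⊢
    exact ⟨by omega, ((hT j).2.2.1 i y x hy hx.1).trans hx.2⟩

theorem rel_toT {r s : ℕ} {lam : Fin r → ℕ → ℕ} {mu : ℕ → ℕ} {c : ℕ → Fin r → ℕ → ℕ}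
    (hc : Pat s lam mu c) : TabRel lam (toT lam c) c := by
  intro m j i t
  constructor
  · intro h
    have h1 : t < lam j i := h.trans_le (hc.le_lam m j i)
    refine ⟨h1, ?_⟩
    simp only [toT, h1, if_true]
    exact Nat.sInf_le h
  · rintro ⟨h1, h2⟩
    simp only [toT, h1, if_true] at h2
    have hne : {m | t < c m j i}.Nonempty := ⟨s, by simpa [hc.top s le_rfl] using h1⟩
    have := Nat.sInf_mem hne
    exact lt_of_lt_of_le this (hc.le_of_le h2 j i)

theorem rel_count {r : ℕ} {lam : Fin r → ℕ → ℕ} {T : Fin r → ℕ → ℕ → ℕ}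
    {c : ℕ → Fin r → ℕ → ℕ} (h : TabRel lam T c) (N : ℕ) (j : Fin r)
    (hN : ∀ i, N ≤ i → lam j i = 0) (m : ℕ) :
    entryCount (lam j) (T j) m + ∑ i ∈ range N, c m j i = ∑ i ∈ range N, c (m+1) j i := by
  have hset : {p : ℕ × ℕ | p.2 < lam j p.1 ∧ T j p.1 p.2 = m + 1} =
      ((((range N).sigma (fun i => Finset.Ico (c m j i) (c (m+1) j i))).map
        (Equiv.sigmaEquivProd ℕ ℕ).toEmbedding : Finset (ℕ × ℕ)) : Set (ℕ × ℕ)) := by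
    ext ⟨i, t⟩
    have h1 := h m j i t
    have h2 := h (m+1) j i t
    simp only [Set.mem_ofPred_eq, Finset.coe_map, Set.mem_image, Finset.mem_coe, Finset.mem_sigma,
      Finset.mem_range, Finset.mem_Ico, Equiv.coe_toEmbedding]
    constructor
    · rintro ⟨g1, g2⟩
      refine ⟨⟨i, t⟩, ⟨?_, ?_, ?_⟩, rfl⟩
      · by_contra! h'
        have := hN i h'
        omega
      · dsimp only
        by_contra! h'
        have := (h1.1 h').2
        omega
      · exact h2.2 ⟨g1, by omega⟩
    · rintro ⟨⟨i', t'⟩, ⟨g0, g1, g2⟩, e⟩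
      simp only [Equiv.sigmaEquivProd_apply, Prod.mk.injEq] at e
      obtain ⟨rfl, rfl⟩ := e
      dsimp only at g0 g1 g2
      have g3 := h2.1 g2
      refine ⟨g3.1, ?_⟩
      by_contra hne
      have := h1.2 ⟨g3.1, by omega⟩
      omega
  unfold entryCount
  rw [hset, Set.ncard_coe_finset, Finset.card_map, Finset.card_sigma, ← Finset.sum_add_distrib]
  apply Finset.sum_congr rfl
  intro i _
  rw [Nat.card_Ico]
  have : c m j i ≤ c (m+1) j i := by
    by_contra! hlt
    have g1 := (h m j i _).1 hlt
    have := (h (m+1) j i (c (m+1) j i)).2 ⟨g1.1, by omega⟩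
    omega
  omega

theorem rel_count_tot {r : ℕ} {lam : Fin r → ℕ → ℕ} {T : Fin r → ℕ → ℕ → ℕ}
    {c : ℕ → Fin r → ℕ → ℕ} (h : TabRel lam T c) (N : ℕ)
    (hN : ∀ j i, N ≤ i → lam j i = 0) (m : ℕ) :
    (∑ j, entryCount (lam j) (T j) m) + ∑ i ∈ range N, tildePart (c m) i
      = ∑ i ∈ range N, tildePart (c (m+1)) i := by
  unfold tildePart
  rw [Finset.sum_comm, Finset.sum_comm (s := range N), ← Finset.sum_add_distrib]
  exact Finset.sum_congr rfl (fun j _ => rel_count h N j (hN j) m)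

theorem sum_extend {r : ℕ} (c : Fin r → ℕ → ℕ) (m N : ℕ) (h : m ≤ N)
    (hz : ∀ j i, m ≤ i → c j i = 0) :
    ∑ i ∈ range m, tildePart c i = ∑ i ∈ range N, tildePart c i := by
  apply Finset.sum_subset
  · intro x; simp; omega
  · intro x _ hx
    simp at hx
    exact tilde_zero (fun j => hz j x hx)

theorem toC_pat {r l N : ℕ} {lam : Fin r → ℕ → ℕ} {mu : ℕ → ℕ} {T : Fin r → ℕ → ℕ → ℕ}
    (hl : ∀ j, Antitone (lam j)) (hlN : l ≤ N) (hN : ∀ j i, N ≤ i → lam j i = 0)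
    (hmu : ∀ i, l ≤ i → mu i = 0)
    (hsum : ∑ i ∈ range N, tildePart lam i = ∑ i ∈ range l, mu i)
    (hT : ∀ j, IsSSYT (lam j) (T j)) (hw : MultiHasWeight lam T mu) :
    Pat l lam mu (toC lam T) := by
  have hR := rel_toC hT
  have hzero : ∀ j i, toC lam T 0 j i = 0 := by
    intro j i
    by_contra h
    have h1 := (hR 0 j i 0).1 (by omega)
    have h2 := (hT j).1 i 0 h1.1
    omega
  have hmono : ∀ m j i, toC lam T m j i ≤ toC lam T (m+1) j i := by
    intro m j i
    apply Finset.card_le_card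
    intro x
    simp
    omega
  have hdiag : ∀ m j i, toC lam T (m+1) j (i+1) ≤ toC lam T m j i := by
    intro m j i
    by_contra! h
    have h1 := (hR (m+1) j (i+1) _).1 h
    have h2 := (hT j).2.2.2 i (i+1) _ (by omega) h1.1
    have h3 := hl j (show i ≤ i + 1 by omega)
    have := (hR m j i (toC lam T m j i)).2 ⟨by omega, by omega⟩
    omega
  have hle : ∀ m j i, toC lam T m j i ≤ lam j i := by
    intro m j i
    exact (Finset.card_filter_le _ _).trans (by simp)
  have hsupp : ∀ m j i, m ≤ i → toC lam T m j i = 0 := by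
    intro m
    induction m with
    | zero => intro j i _; exact hzero j i
    | succ m ih =>
      intro j i hi
      obtain ⟨i, rfl⟩ : ∃ x, i = x + 1 := ⟨i - 1, by omega⟩
      have := hdiag m j i
      rw [ih j i (by omega)] at this
      omega
  have htot : ∀ m, ∑ i ∈ range N, tildePart (toC lam T m) i = ∑ i ∈ range m, mu i := by
    intro m
    induction m with
    | zero =>
      simp
      intro i _
      exact tilde_zero (fun j => hzero j i)
    | succ m ih =>
      rw [← rel_count_tot hR N hN m, hw m, ih, Finset.sum_range_succ]
      omega
  refine ⟨hzero, ?_, hmono, hdiag, ?_⟩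
  · intro m hm
    have e : ∑ i ∈ range m, mu i = ∑ i ∈ range l, mu i := by
      symm
      apply Finset.sum_subset
      · intro x; simp; omega
      · intro x _ hx
        simp at hx
        exact hmu x hx
    have := eq_of_sum_eq (hle m) N (by rw [hsum, htot m, e])
    funext j i
    rcases Nat.lt_or_ge i N with h | h
    · exact this i h j
    · have := hle m j i
      rw [hN j i h] at *
      omega
  · intro m hm
    rw [sum_extend _ m N (by omega) (hsupp m), htot m]

theorem toT_ssyt {r l : ℕ} {lam : Fin r → ℕ → ℕ} {mu : ℕ → ℕ} {c : ℕ → Fin r → ℕ → ℕ}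
    (hl : ∀ j, Antitone (lam j)) (hc : Pat l lam mu c) (j : Fin r) :
    IsSSYT (lam j) (toT lam c j) := by
  have hR := rel_toT hc
  have hpos : ∀ i t, t < lam j i → 1 ≤ toT lam c j i t := by
    intro i t h
    by_contra! h'
    have := (hR 0 j i t).2 ⟨h, by omega⟩
    rw [hc.zero] at this
    omega
  have hcol : ∀ i t, t < lam j (i+1) → toT lam c j i t < toT lam c j (i+1) t := by
    intro i t h
    have h1 := hpos (i+1) t h
    have h2 := (hR (toT lam c j (i+1) t) j (i+1) t).2 ⟨h, le_rfl⟩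
    obtain ⟨m, hm⟩ : ∃ m, toT lam c j (i+1) t = m + 1 := ⟨toT lam c j (i+1) t - 1, by omega⟩
    rw [hm] at h2 ⊢
    have := ((hR m j i t).1 (h2.trans_le (hc.diag m j i))).2
    omega
  refine ⟨hpos, ?_, ?_, ?_⟩
  · intro i t h
    simp [toT, show ¬ t < lam j i by omega]
  · intro i t u htu hu
    have := (hR (toT lam c j i u) j i u).2 ⟨hu, le_rfl⟩
    exact ((hR (toT lam c j i u) j i t).1 (by omega)).2
  · intro i i' t hii
    induction i', hii using Nat.le_induction with
    | base => exact hcol i t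
    | succ n h ih =>
      intro h'
      exact (ih (h'.trans_le (hl j (by omega)))).trans (hcol n t h')

theorem toT_weight {r l N : ℕ} {lam : Fin r → ℕ → ℕ} {mu : ℕ → ℕ} {c : ℕ → Fin r → ℕ → ℕ}
    (hlN : l ≤ N) (hN : ∀ j i, N ≤ i → lam j i = 0)
    (hmu : ∀ i, l ≤ i → mu i = 0) (hc : Pat l lam mu c) :
    MultiHasWeight lam (toT lam c) mu := by
  intro m
  have h := rel_count_tot (rel_toT hc) N hN m
  rcases Nat.lt_or_ge m l with hm | hm
  · rw [← sum_extend _ m N (by omega) (hc.supp m),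
      ← sum_extend _ (m+1) N (by omega) (hc.supp (m+1)), hc.sum m hm.le, hc.sum (m+1) hm,
      Finset.sum_range_succ] at h
    omega
  · rw [hc.top m hm, hc.top (m+1) (by omega)] at h
    rw [hmu m hm]
    omega

theorem rel_c_unique {r : ℕ} {lam : Fin r → ℕ → ℕ} {T : Fin r → ℕ → ℕ → ℕ}
    {c c' : ℕ → Fin r → ℕ → ℕ} (h : TabRel lam T c) (h' : TabRel lam T c') : c = c' := by
  funext m j i
  apply le_antisymm
  · by_contra! hlt
    have := (h' m j i _).2 ((h m j i _).1 hlt)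
    omega
  · by_contra! hlt
    have := (h m j i _).2 ((h' m j i _).1 hlt)
    omega

theorem rel_T_unique {r : ℕ} {lam : Fin r → ℕ → ℕ} {T T' : Fin r → ℕ → ℕ → ℕ}
    {c : ℕ → Fin r → ℕ → ℕ} (hT : ∀ j, IsSSYT (lam j) (T j)) (hT' : ∀ j, IsSSYT (lam j) (T' j))
    (h : TabRel lam T c) (h' : TabRel lam T' c) : T = T' := by
  funext j i t
  rcases Nat.lt_or_ge t (lam j i) with ht | ht
  · apply le_antisymm
    · exact ((h _ j i t).1 ((h' _ j i t).2 ⟨ht, le_rfl⟩)).2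
    · exact ((h' _ j i t).1 ((h _ j i t).2 ⟨ht, le_rfl⟩)).2
  · rw [(hT j).2.1 i t ht, (hT' j).2.1 i t ht]

theorem psize_eq (f : ℕ → ℕ) (N : ℕ) (h : ∀ i, N ≤ i → f i = 0) :
    psize f = ∑ i ∈ range N, f i := by
  unfold psize
  apply finsum_eq_sum_of_support_subset
  intro x hx
  simp only [Function.mem_support] at hx
  simp only [Finset.coe_range, Set.mem_Iio]
  by_contra! h'
  exact hx (h x h')

theorem kostka_iff {r l N : ℕ} {lam : Fin r → ℕ → ℕ} {mu : ℕ → ℕ}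
    (hl : ∀ j, Antitone (lam j)) (hlN : l ≤ N) (hN : ∀ j i, N ≤ i → lam j i = 0)
    (hmu : ∀ i, l ≤ i → mu i = 0)
    (hsum : ∑ i ∈ range N, tildePart lam i = ∑ i ∈ range l, mu i) :
    kostkaMulti lam mu = 1 ↔ ∃ c, Pat l lam mu c ∧ ∀ c', Pat l lam mu c' → c' = c := by
  unfold kostkaMulti
  rw [Set.ncard_eq_one]
  constructor
  · rintro ⟨T, hT⟩
    have hmem : T ∈ ({T} : Set _) := rfl
    rw [← hT] at hmem
    obtain ⟨h1, h2⟩ := hmem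
    refine ⟨toC lam T, toC_pat hl hlN hN hmu hsum h1 h2, fun c' hc' => ?_⟩
    have : toT lam c' ∈ ({T} : Set _) := by
      rw [← hT]
      exact ⟨toT_ssyt hl hc', toT_weight hlN hN hmu hc'⟩
    have hR := rel_toT hc'
    rw [Set.mem_singleton_iff.1 this] at hR
    exact rel_c_unique hR (rel_toC h1)
  · rintro ⟨c, hc, hu⟩
    refine ⟨toT lam c, ?_⟩
    ext T
    simp only [Set.mem_ofPred_eq, Set.mem_singleton_iff]
    constructor
    · rintro ⟨h1, h2⟩
      have e := hu _ (toC_pat hl hlN hN hmu hsum h1 h2)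
      have hR := rel_toC h1
      rw [e] at hR
      exact rel_T_unique h1 (toT_ssyt hl hc) hR (rel_toT hc)
    · rintro rfl
      exact ⟨toT_ssyt hl hc, toT_weight hlN hN hmu hc⟩

/-- The main theorem: Kostka multiplicity one for multipartitions. The indices
`0 = i_0 < i_1 < ⋯ < i_t = l` are encoded as `f 0 = 0`, `f t = l`, `f` strictly
increasing; block `k` consists of the 0-indexed rows `f k, …, f (k+1) - 1`. -/
theorem stmt15 (r n l : ℕ) (lam : Fin r → ℕ → ℕ) (mu : ℕ → ℕ)
    (hlp : ∀ j, IsPartition (lam j)) (hln : (∑ j, psize (lam j)) = n)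
    (hmp : IsPartition mu) (hmn : psize mu = n) (hml : PartLength mu l) :
    kostkaMulti lam mu = 1 ↔
      ∃ (t : ℕ) (f : ℕ → ℕ), f 0 = 0 ∧ f t = l ∧ (∀ k, k < t → f k < f (k + 1)) ∧
        ∀ k, k < t →
          ((∑ i ∈ Finset.Ico (f k) (f (k + 1)), tildePart lam i
              = ∑ i ∈ Finset.Ico (f k) (f (k + 1)), mu i) ∧
           (∀ m, f k ≤ m → m ≤ f (k + 1) →
              ∑ i ∈ Finset.Ico (f k) m, mu i
                ≤ ∑ i ∈ Finset.Ico (f k) m, tildePart lam i)) ∧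
          -- at most one `j` fails to have all parts in the block equal
          ((∀ j j' : Fin r,
              ¬ (∀ a b, f k ≤ a → a ≤ b → b < f (k + 1) → lam j a = lam j b) →
              ¬ (∀ a b, f k ≤ a → a ≤ b → b < f (k + 1) → lam j' a = lam j' b) →
              j = j') ∧
           -- and every `j` has all parts equal, or all-but-the-last equal and greater
           -- than the last, or the first greater than all the remaining equal parts
           (∀ j : Fin r,
              (∀ a b, f k ≤ a → a ≤ b → b < f (k + 1) → lam j a = lam j b) ∨
              ((lam j (f (k + 1) - 1) < lam j (f k) ∧
                 ∀ a b, f k ≤ a → a ≤ b → b + 1 < f (k + 1) → lam j a = lam j b) ∨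
               (lam j (f k + 1) < lam j (f k) ∧
                 ∀ a b, f k + 1 ≤ a → a ≤ b → b < f (k + 1) → lam j a = lam j b)))) := by
  have hl : ∀ j, Antitone (lam j) := fun j => (hlp j).1
  choose B hB using fun j => (hlp j).2
  obtain ⟨N, hlN, hN⟩ : ∃ N, l ≤ N ∧ ∀ j i, N ≤ i → lam j i = 0 := by
    refine ⟨l + ∑ j, B j, by omega, fun j i hi => hB j i ?_⟩
    have := Finset.single_le_sum (f := B) (fun _ _ => Nat.zero_le _) (Finset.mem_univ j)
    omega
  have hsum : ∑ i ∈ range N, tildePart lam i = ∑ i ∈ range l, mu i := by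
    rw [← psize_eq mu l hml.2, hmn, ← hln]
    unfold tildePart
    rw [Finset.sum_comm]
    exact Finset.sum_congr rfl (fun j _ => (psize_eq (lam j) N (hN j)).symm)
  rw [kostka_iff hl hlN hN hml.2 hsum]
  refine core lam mu hl hmp.1 ?_
  intro h j i hi
  rcases Nat.lt_or_ge i N with hiN | hiN
  · have e := Finset.sum_range_add_sum_Ico (tildePart lam) hlN
    have e0 : ∑ x ∈ Finset.Ico l N, tildePart lam x = 0 := by omega
    have e1 := Finset.sum_eq_zero_iff.1 e0 i (by rw [Finset.mem_Ico]; omega)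
    exact Finset.sum_eq_zero_iff.1 e1 j (by simp)
  · exact hN j i hiN
end

section
/- Let [λ(j)] be an r-multipartition of n and λ̃ the partition with parts λ̃_i = Σ_j λ(j)_i. The only partition μ of n with K_{[λ(j)]μ} = 1 is μ = λ̃ if and only if for every i, either λ̃_i - λ̃_{i+1} ≤ 1, or there exist at least two indices j with λ(j)_i - λ(j)_{i+1} ≥ 1 (with λ̃_i = 0 for i > ℓ(λ̃) and λ(j)_i = 0 for i > ℓ(λ(j))). -/
open Finset in
theorem aux_sum_fiber {α : Type*} [DecidableEq α] (D : Finset α) (f : α → ℕ)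
    (hf : ∀ p ∈ D, 1 ≤ f p) (k : ℕ) :
    ∑ m ∈ range k, (D.filter fun p => f p = m + 1).card = (D.filter fun p => f p ≤ k).card := by
  induction k with
  | zero =>
    symm
    rw [sum_range_zero, card_eq_zero, filter_eq_empty_iff]
    intro p hp h
    have := hf p hp
    omega
  | succ k ih =>
    rw [sum_range_succ, ih, ← card_union_of_disjoint]
    · congr 1
      ext p
      simp only [mem_union, mem_filter]
      constructor
      · rintro (⟨h1, h2⟩ | ⟨h1, h2⟩)
        · exact ⟨h1, by omega⟩
        · exact ⟨h1, by omega⟩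
      · rintro ⟨h1, h2⟩
        by_cases h : f p ≤ k
        · exact Or.inl ⟨h1, h⟩
        · exact Or.inr ⟨h1, by omega⟩
    · rw [disjoint_left]
      intro p h1 h2
      simp only [mem_filter] at h1 h2
      omega

/-- partial sums -/
def psum (w : ℕ → ℕ) (k : ℕ) : ℕ := ∑ i ∈ Finset.range k, w i

theorem psum_succ (w : ℕ → ℕ) (k : ℕ) : psum w (k + 1) = psum w k + w k :=
  Finset.sum_range_succ _ _

/-- move one unit of weight from `s` to `t`. -/
def mv (w : ℕ → ℕ) (s t : ℕ) : ℕ → ℕ :=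
  fun x => if x = s then w x - 1 else if x = t then w x + 1 else w x

theorem psum_mv (w : ℕ → ℕ) (s t : ℕ) (hst : s < t) (hs : 0 < w s) (k : ℕ) :
    psum (mv w s t) k + (if s < k ∧ k ≤ t then 1 else 0) = psum w k := by
  induction k with
  | zero => simp [psum]
  | succ k ih =>
    rw [psum_succ, psum_succ, ← ih]
    unfold mv
    rcases lt_trichotomy k s with h | h | h
    · have : k ≠ s := by omega
      have h3 : k ≠ t := by omega
      have h4 : ¬ (s < k ∧ k ≤ t) := by omega
      have h5 : ¬ (s < k + 1 ∧ k + 1 ≤ t) := by omega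
      rw [if_neg h4, if_neg h5, if_neg this, if_neg h3]
      omega
    · subst h
      have h4 : ¬ (k < k ∧ k ≤ t) := by omega
      have h5 : (k < k + 1 ∧ k + 1 ≤ t) := by omega
      rw [if_neg h4, if_pos h5, if_pos rfl]
      omega
    · have h1 : k ≠ s := by omega
      rw [if_neg h1]
      by_cases h3 : k = t
      · have h4 : (s < k ∧ k ≤ t) := by omega
        have h5 : ¬ (s < k + 1 ∧ k + 1 ≤ t) := by omega
        rw [if_pos h4, if_neg h5, if_pos h3]
        omega
      · rw [if_neg h3]
        by_cases h4 : k ≤ t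
        · rw [if_pos (by omega), if_pos (by omega)]; omega
        · rw [if_neg (by omega), if_neg (by omega)]; omega

theorem find_st (mu w : ℕ → ℕ) (N : ℕ) (hdom : ∀ k, psum mu k ≤ psum w k)
    (hN : ∀ k, N ≤ k → psum w k = psum mu k) (hne : w ≠ mu) :
    ∃ s t, s < t ∧ mu s < w s ∧ w t < mu t ∧ (∀ u, s < u → u < t → w u = mu u) ∧
      ∀ k, s < k → k ≤ t → psum mu k < psum w k := by
  classical
  have hex : ∃ t, w t < mu t := by
    by_contra hcon
    push Not at hcon
    obtain ⟨x, hx⟩ := Function.ne_iff.mp hne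
    have hx' : mu x < w x := lt_of_le_of_ne (hcon x) (Ne.symm hx)
    have h1 := hN (max N (x + 1)) (le_max_left _ _)
    have h2 : psum mu (max N (x+1)) < psum w (max N (x+1)) := by
      apply Finset.sum_lt_sum
      · intro i _; exact hcon i
      · exact ⟨x, by simp, hx'⟩
    omega
  set t := Nat.find hex with ht
  have ht1 : w t < mu t := Nat.find_spec hex
  have ht2 : ∀ u, u < t → mu u ≤ w u := fun u hu => by
    have := Nat.find_min hex hu
    omega
  have hex2 : ∃ s, s < t ∧ mu s < w s := by
    by_contra hcon
    push Not at hcon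
    have h1 : psum w t = psum mu t := by
      apply Finset.sum_congr rfl
      intro i hi
      rw [Finset.mem_range] at hi
      exact le_antisymm (hcon i hi) (ht2 i hi)
    have h2 := hdom (t + 1)
    rw [psum_succ, psum_succ] at h2
    omega
  obtain ⟨s0, hs0, hs0'⟩ := hex2
  set s := Nat.findGreatest (fun s => s < t ∧ mu s < w s) t with hs
  have hs1 : s < t ∧ mu s < w s :=
    Nat.findGreatest_spec (P := fun s => s < t ∧ mu s < w s) hs0.le ⟨hs0, hs0'⟩
  have hs2 : ∀ u, s < u → u < t → w u = mu u := by
    intro u h1 h2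
    have := Nat.findGreatest_is_greatest (P := fun s => s < t ∧ mu s < w s) h1 h2.le
    have := ht2 u h2
    omega
  refine ⟨s, t, hs1.1, hs1.2, ht1, hs2, ?_⟩
  intro k hk hkt
  induction k with
  | zero => omega
  | succ k ih =>
    rw [psum_succ, psum_succ]
    by_cases h : s = k
    · have := hdom k
      have := hs1.2
      rw [h] at this
      omega
    · have := ih (by omega) (by omega)
      have := hs2 k (by omega) (by omega)
      omega

theorem chain (Two : (ℕ → ℕ) → Prop) (mu : ℕ → ℕ) (hmu : Antitone mu) (N : ℕ)
    (step : ∀ w m, w (m + 1) < w m → Two w → Two (mv w m (m + 1))) :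
    ∀ d w, (∑ k ∈ Finset.range N, psum w k) = d → (∀ k, psum mu k ≤ psum w k) →
      (∀ k, N ≤ k → psum w k = psum mu k) → Two w → Two mu := by
  intro d
  induction d using Nat.strong_induction_on with
  | _ d ih =>
    intro w hd hdom hN h2
    by_cases hne : w = mu
    · rwa [← hne]
    obtain ⟨s, t, hst, hs, ht, hu, hgap⟩ := find_st mu w N hdom hN hne
    have hlt : w (s + 1) < w s := by
      have h1 := hmu (Nat.le_succ s)
      by_cases h : s + 1 = t
      · subst h; simp only [Nat.succ_eq_add_one] at h1; omega
      · have := hu (s+1) (by omega) (by omega)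
        simp only [Nat.succ_eq_add_one] at h1; omega
    have hg := hgap (s + 1) (by omega) (by omega)
    have hsN : s + 1 < N := by
      by_contra h
      have := hN (s + 1) (by omega)
      omega
    have hp := psum_mv w s (s + 1) (by omega) (by omega)
    refine ih _ ?_ (mv w s (s + 1)) rfl ?_ ?_ (step w s hlt h2)
    · rw [← hd]
      apply Finset.sum_lt_sum
      · intro i _
        have := hp i
        omega
      · refine ⟨s + 1, by simpa using hsN, ?_⟩
        have := hp (s + 1)
        rw [if_pos (by omega)] at this
        omega
    · intro k
      have h1 := hp k
      split_ifs at h1 with h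
      · have : k = s + 1 := by omega
        subst this
        omega
      · have := hdom k
        omega
    · intro k hk
      have h1 := hp k
      rw [if_neg (by omega)] at h1
      have := hN k hk
      omega

/-- update a single cell. -/
def upd {r : ℕ} (T : Fin r → ℕ → ℕ → ℕ) (p : Fin r × ℕ × ℕ) (v : ℕ) : Fin r → ℕ → ℕ → ℕ :=
  fun j a c => if (j, a, c) = p then v else T j a c

/-- value at a cell. -/
def vl {r : ℕ} (T : Fin r → ℕ → ℕ → ℕ) (p : Fin r × ℕ × ℕ) : ℕ := T p.1 p.2.1 p.2.2

theorem vl_upd {r : ℕ} (T : Fin r → ℕ → ℕ → ℕ) (p q : Fin r × ℕ × ℕ) (v : ℕ) :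
    vl (upd T p v) q = if q = p then v else vl T q := rfl

theorem vl_ext {r : ℕ} {T T' : Fin r → ℕ → ℕ → ℕ} (h : ∀ q, vl T q = vl T' q) : T = T' := by
  funext j a c
  exact h (j, a, c)

/-- multitableaux of total weight `w`. -/
def MT {r : ℕ} (lam : Fin r → ℕ → ℕ) (D : Finset (Fin r × ℕ × ℕ)) (w : ℕ → ℕ)
    (T : Fin r → ℕ → ℕ → ℕ) : Prop :=
  (∀ j, IsSSYT (lam j) (T j)) ∧ ∀ m, (D.filter fun p => vl T p = m + 1).card = w m

theorem exists_cells {r : ℕ} (lam : Fin r → ℕ → ℕ) (hlp : ∀ j, IsPartition (lam j)) :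
    ∃ (D : Finset (Fin r × ℕ × ℕ)) (N : ℕ), (∀ p, p ∈ D ↔ p.2.2 < lam p.1 p.2.1) ∧
      ∀ j i, N ≤ i → lam j i = 0 := by
  choose f hf using fun j => (hlp j).2
  have hN : ∀ j i, (∑ j, f j) ≤ i → lam j i = 0 := by
    intro j i hi
    apply hf j i
    exact le_trans (Finset.single_le_sum (f := f) (fun _ _ => Nat.zero_le _) (Finset.mem_univ j)) hi
  refine ⟨((Finset.univ ×ˢ (Finset.range (∑ j, f j) ×ˢ Finset.range (∑ j, lam j 0)))).filter
    fun p => p.2.2 < lam p.1 p.2.1, ∑ j, f j, ?_, hN⟩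
  rintro ⟨j, a, c⟩
  simp only [Finset.mem_filter, Finset.mem_product, Finset.mem_univ, Finset.mem_range, true_and,
    and_iff_right_iff_imp]
  intro h
  constructor
  · by_contra hcon
    have := hN j a (by omega)
    omega
  · have h1 := (hlp j).1 (Nat.zero_le a)
    have h2 := Finset.single_le_sum (f := fun j => lam j 0) (fun _ _ => Nat.zero_le _)
      (Finset.mem_univ j)
    omega

theorem multi_iff {r : ℕ} (lam : Fin r → ℕ → ℕ) (D : Finset (Fin r × ℕ × ℕ))
    (hD : ∀ p, p ∈ D ↔ p.2.2 < lam p.1 p.2.1) (w : ℕ → ℕ) (T : Fin r → ℕ → ℕ → ℕ) :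
    ((∀ j, IsSSYT (lam j) (T j)) ∧ MultiHasWeight lam T w) ↔ MT lam D w T := by
  unfold MT MultiHasWeight
  have : ∀ m, (∑ j, entryCount (lam j) (T j) m) = (D.filter fun p => vl T p = m + 1).card := by
    intro m
    rw [Finset.card_eq_sum_card_fiberwise (f := Prod.fst) (t := Finset.univ)
      (fun _ _ => Finset.mem_coe.2 (Finset.mem_univ _))]
    apply Finset.sum_congr rfl
    intro j _
    unfold entryCount
    rw [← Set.ncard_coe_finset]
    apply Set.ncard_congr (fun p _ => (j, p))
    · intro p hp
      simp only [Finset.coe_filter, Set.mem_ofPred_eq, hD, Finset.mem_filter]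
      exact ⟨hp, trivial⟩
    · intro p q _ _ h
      exact (Prod.mk.inj h).2
    · rintro ⟨j', p⟩ hp
      simp only [Finset.coe_filter, Set.mem_ofPred_eq, hD, Finset.mem_filter] at hp
      obtain ⟨⟨h1, h2⟩, h3⟩ := hp
      subst h3
      exact ⟨p, ⟨h1, h2⟩, rfl⟩
  simp only [this]

theorem row_count {r : ℕ} (lam : Fin r → ℕ → ℕ) (D : Finset (Fin r × ℕ × ℕ))
    (hD : ∀ p, p ∈ D ↔ p.2.2 < lam p.1 p.2.1) (a : ℕ) :
    (D.filter fun p => p.2.1 + 1 = a + 1).card = tildePart lam a := by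
  unfold tildePart
  rw [Finset.card_eq_sum_card_fiberwise (f := Prod.fst) (t := Finset.univ)
      (fun _ _ => Finset.mem_coe.2 (Finset.mem_univ _))]
  apply Finset.sum_congr rfl
  intro j _
  symm
  rw [← Finset.card_range (lam j a)]
  apply Finset.card_bij (fun c _ => (j, a, c))
  · intro c hc
    simp only [Finset.mem_filter, hD]
    exact ⟨⟨by simpa using hc, trivial⟩, trivial⟩
  · intro c _ c' _ h
    simpa using h
  · rintro ⟨j', a', c⟩ hp
    simp only [Finset.mem_filter, hD] at hp
    obtain ⟨⟨h1, h2⟩, h3⟩ := hp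
    have : a' = a := by omega
    subst this
    subst h3
    exact ⟨c, by simpa using h1, rfl⟩

theorem ssyt_row_le {l : ℕ → ℕ} {T : ℕ → ℕ → ℕ} (hl : Antitone l) (hT : IsSSYT l T) :
    ∀ a c, c < l a → a + 1 ≤ T a c := by
  intro a
  induction a with
  | zero => intro c hc; exact hT.1 0 c hc
  | succ a ih =>
    intro c hc
    have h1 := hT.2.2.2 a (a + 1) c (by omega) hc
    have h2 := ih c (lt_of_lt_of_le hc (hl (Nat.le_succ a)))
    omega

theorem psum_weight {r : ℕ} {lam : Fin r → ℕ → ℕ} {D : Finset (Fin r × ℕ × ℕ)}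
    (hD : ∀ p, p ∈ D ↔ p.2.2 < lam p.1 p.2.1) {w : ℕ → ℕ} {T : Fin r → ℕ → ℕ → ℕ}
    (hT : MT lam D w T) (k : ℕ) : psum w k = (D.filter fun p => vl T p ≤ k).card := by
  rw [← aux_sum_fiber D (vl T) (fun p hp => (hT.1 p.1).1 _ _ ((hD p).1 hp)) k]
  exact Finset.sum_congr rfl fun m _ => (hT.2 m).symm

theorem psum_tilde {r : ℕ} {lam : Fin r → ℕ → ℕ} {D : Finset (Fin r × ℕ × ℕ)}
    (hD : ∀ p, p ∈ D ↔ p.2.2 < lam p.1 p.2.1) (k : ℕ) :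
    psum (tildePart lam) k = (D.filter fun p => p.2.1 + 1 ≤ k).card := by
  rw [← aux_sum_fiber D (fun p => p.2.1 + 1) (fun p hp => by omega) k]
  exact Finset.sum_congr rfl fun m _ => (row_count lam D hD m).symm

theorem le_subset {r : ℕ} {lam : Fin r → ℕ → ℕ} (hlp : ∀ j, IsPartition (lam j))
    {D : Finset (Fin r × ℕ × ℕ)}
    (hD : ∀ p, p ∈ D ↔ p.2.2 < lam p.1 p.2.1) {w : ℕ → ℕ} {T : Fin r → ℕ → ℕ → ℕ}
    (hT : MT lam D w T) (k : ℕ) :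
    (D.filter fun p => vl T p ≤ k) ⊆ D.filter fun p => p.2.1 + 1 ≤ k := by
  intro p hp
  rw [Finset.mem_filter] at hp ⊢
  have := ssyt_row_le (hlp p.1).1 (hT.1 p.1) p.2.1 p.2.2 ((hD p).1 hp.1)
  exact ⟨hp.1, le_trans this hp.2⟩

theorem dom_of_MT {r : ℕ} {lam : Fin r → ℕ → ℕ} (hlp : ∀ j, IsPartition (lam j))
    {D : Finset (Fin r × ℕ × ℕ)}
    (hD : ∀ p, p ∈ D ↔ p.2.2 < lam p.1 p.2.1) {w : ℕ → ℕ} {T : Fin r → ℕ → ℕ → ℕ}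
    (hT : MT lam D w T) (k : ℕ) : psum w k ≤ psum (tildePart lam) k := by
  rw [psum_weight hD hT, psum_tilde hD]
  exact Finset.card_le_card (le_subset hlp hD hT k)

theorem entry_le {r : ℕ} {lam : Fin r → ℕ → ℕ} (hlp : ∀ j, IsPartition (lam j))
    {D : Finset (Fin r × ℕ × ℕ)}
    (hD : ∀ p, p ∈ D ↔ p.2.2 < lam p.1 p.2.1) {w : ℕ → ℕ} {T : Fin r → ℕ → ℕ → ℕ}
    (hT : MT lam D w T) (k : ℕ) (hk : psum w k = psum (tildePart lam) k)
    (p : Fin r × ℕ × ℕ) (hp : p ∈ D) (hr : p.2.1 < k) : vl T p ≤ k := by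
  rw [psum_weight hD hT, psum_tilde hD] at hk
  have h := Finset.eq_of_subset_of_card_le (le_subset hlp hD hT k) hk.ge
  have : p ∈ D.filter fun p => p.2.1 + 1 ≤ k := Finset.mem_filter.2 ⟨hp, hr⟩
  rw [← h] at this
  exact (Finset.mem_filter.1 this).2

theorem upd_weight {r : ℕ} {D : Finset (Fin r × ℕ × ℕ)}
    {w : ℕ → ℕ} {T : Fin r → ℕ → ℕ → ℕ}
    (hT : ∀ m, (D.filter fun p => vl T p = m + 1).card = w m)
    (p : Fin r × ℕ × ℕ) (hp : p ∈ D) (m m' : ℕ) (hv : vl T p = m + 1) (hm : m ≠ m') (x : ℕ) :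
    (D.filter fun q => vl (upd T p (m' + 1)) q = x + 1).card = mv w m m' x := by
  classical
  unfold mv
  split_ifs with h1 h2
  · subst h1
    rw [← hT, ← Finset.card_erase_of_mem (a := p)]
    · congr 1
      ext q
      rw [Finset.mem_filter, Finset.mem_erase, Finset.mem_filter, vl_upd]
      by_cases h : q = p
      · rw [if_pos h]
        constructor
        · rintro ⟨_, h4⟩; omega
        · rintro ⟨h4, _⟩; exact absurd h h4
      · rw [if_neg h]; tauto
    · rw [Finset.mem_filter]; exact ⟨hp, hv⟩
  · subst h2
    rw [← hT, ← Finset.card_insert_of_notMem (a := p)]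
    · congr 1
      ext q
      rw [Finset.mem_filter, Finset.mem_insert, Finset.mem_filter, vl_upd]
      by_cases h : q = p
      · rw [if_pos h, h]; tauto
      · rw [if_neg h]; tauto
    · rw [Finset.mem_filter]; rintro ⟨_, h⟩; omega
  · rw [← hT]
    congr 1
    ext q
    rw [Finset.mem_filter, Finset.mem_filter, vl_upd]
    by_cases h : q = p
    · rw [if_pos h, h]
      constructor
      · rintro ⟨_, h4⟩; omega
      · rintro ⟨_, h4⟩; omega
    · rw [if_neg h]

theorem upd_ssyt {r : ℕ} {lam : Fin r → ℕ → ℕ} (hlp : ∀ j, IsPartition (lam j))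
    {T : Fin r → ℕ → ℕ → ℕ} (hT : ∀ j, IsSSYT (lam j) (T j)) (j : Fin r) (a c v : ℕ)
    (hc : c < lam j a) (hv : T j a c ≤ v)
    (hrow : c + 1 < lam j a → v ≤ T j a (c + 1))
    (hcol : c < lam j (a + 1) → v < T j (a + 1) c) :
    ∀ j', IsSSYT (lam j') (upd T (j, a, c) v j') := by
  intro j'
  by_cases hj : j' = j
  swap
  · have : upd T (j, a, c) v j' = T j' := by
      funext a' c'
      simp [upd, hj]
    rw [this]
    exact hT j'
  subst hj
  have hl := (hlp j').1
  obtain ⟨h1, h2, h3, h4⟩ := hT j'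
  have e : ∀ a' c', upd T (j', a, c) v j' a' c' = if a' = a ∧ c' = c then v else T j' a' c' := by
    intro a' c'
    simp [upd]
  refine ⟨?_, ?_, ?_, ?_⟩
  · intro a' c' h
    rw [e]
    split_ifs
    · exact le_trans (h1 a c hc) hv
    · exact h1 _ _ h
  · intro a' c' h
    rw [e, if_neg]
    · exact h2 _ _ h
    · rintro ⟨rfl, rfl⟩; omega
  · intro a' c' k hck hk
    rw [e, e]
    split_ifs with hA hB hB
    · exact le_rfl
    · obtain ⟨rfl, rfl⟩ := hA
      have : c' < k := lt_of_le_of_ne hck (fun h => hB ⟨rfl, h.symm⟩)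
      exact le_trans (hrow (by omega)) (h3 _ _ _ (by omega) hk)
    · obtain ⟨rfl, rfl⟩ := hB
      exact le_trans (h3 _ _ _ hck hk) hv
    · exact h3 _ _ _ hck hk
  · intro i i' c' hi hc'
    rw [e, e]
    split_ifs with hA hB hB
    · omega
    · obtain ⟨rfl, rfl⟩ := hA
      have hx := hcol (lt_of_lt_of_le hc' (hl hi))
      by_cases h : i + 1 = i'
      · rwa [← h]
      · exact lt_trans hx (h4 _ _ _ (by omega) hc')
    · obtain ⟨rfl, rfl⟩ := hB
      exact lt_of_lt_of_le (h4 _ _ _ hi hc') hv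
    · exact h4 _ _ _ hi hc'

def Low {r : ℕ} (lam : Fin r → ℕ → ℕ) (T : Fin r → ℕ → ℕ → ℕ) (m : ℕ) (p : Fin r × ℕ × ℕ) : Prop :=
  p.2.2 < lam p.1 p.2.1 ∧ vl T p = m + 1 ∧
  (p.2.2 + 1 < lam p.1 p.2.1 → T p.1 p.2.1 (p.2.2 + 1) ≠ m + 1) ∧
  T p.1 (p.2.1 + 1) p.2.2 ≠ m + 2

theorem low_upd {r : ℕ} {lam : Fin r → ℕ → ℕ} (hlp : ∀ j, IsPartition (lam j))
    {D : Finset (Fin r × ℕ × ℕ)}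
    (hD : ∀ p, p ∈ D ↔ p.2.2 < lam p.1 p.2.1) {w : ℕ → ℕ} {T : Fin r → ℕ → ℕ → ℕ}
    (hT : MT lam D w T) (m : ℕ) (p : Fin r × ℕ × ℕ) (hp : Low lam T m p) :
    MT lam D (mv w m (m + 1)) (upd T p (m + 2)) := by
  obtain ⟨h1, h2, h3, h4⟩ := hp
  refine ⟨?_, upd_weight hT.2 p ((hD p).2 h1) m (m + 1) h2 (by omega)⟩
  obtain ⟨j, a, c⟩ := p
  simp only [vl] at h1 h2 h3 h4
  obtain ⟨g1, g2, g3, g4⟩ := hT.1 j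
  apply upd_ssyt hlp hT.1
  · exact h1
  · omega
  · intro h
    have := g3 a c (c + 1) (by omega) h
    have := h3 h
    omega
  · intro h
    have := g4 a (a + 1) c (by omega) h
    omega

theorem exists_low {r : ℕ} {lam : Fin r → ℕ → ℕ} (hlp : ∀ j, IsPartition (lam j))
    {T : Fin r → ℕ → ℕ → ℕ} (hT : ∀ j, IsSSYT (lam j) (T j)) (m : ℕ) (j : Fin r) (a c : ℕ)
    (hc : c < lam j a) (hv : T j a c = m + 1) (hb : T j (a + 1) c ≠ m + 2) :
    ∃ c', Low lam T m (j, a, c') := by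
  classical
  obtain ⟨g1, g2, g3, g4⟩ := hT j
  let P : ℕ → Prop := fun x => x < lam j a ∧ T j a x = m + 1
  have hP : P c := ⟨hc, hv⟩
  set x := Nat.findGreatest P (lam j a) with hx
  have hx1 : P x := Nat.findGreatest_spec hc.le hP
  have hx2 : c ≤ x := Nat.le_findGreatest hc.le hP
  refine ⟨x, hx1.1, hx1.2, ?_, ?_⟩
  · intro h h'
    simp only at h h'
    have : x + 1 ≤ x := Nat.le_findGreatest (P := P) h.le ⟨h, h'⟩
    omega
  · intro h
    simp only at h
    have hlt : x < lam j (a + 1) := by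
      by_contra hcon
      have := g2 (a + 1) x (by omega)
      omega
    have h5 := g3 (a + 1) c x hx2 hlt
    have h6 := g4 a (a + 1) c (by omega) (by omega)
    omega

/-- at least two multitableaux -/
def Two {r : ℕ} (lam : Fin r → ℕ → ℕ) (D : Finset (Fin r × ℕ × ℕ)) (w : ℕ → ℕ) : Prop :=
  ∃ T T', T ≠ T' ∧ MT lam D w T ∧ MT lam D w T'

theorem two_of_two_low {r : ℕ} {lam : Fin r → ℕ → ℕ} (hlp : ∀ j, IsPartition (lam j))
    {D : Finset (Fin r × ℕ × ℕ)}
    (hD : ∀ p, p ∈ D ↔ p.2.2 < lam p.1 p.2.1) {w : ℕ → ℕ} {T : Fin r → ℕ → ℕ → ℕ}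
    (hT : MT lam D w T) (m : ℕ) (p q : Fin r × ℕ × ℕ) (hp : Low lam T m p) (hq : Low lam T m q)
    (hpq : p ≠ q) : Two lam D (mv w m (m + 1)) := by
  refine ⟨_, _, ?_, low_upd hlp hD hT m p hp, low_upd hlp hD hT m q hq⟩
  intro h
  have h1 : vl (upd T p (m + 2)) p = vl (upd T q (m + 2)) p := by rw [h]
  rw [vl_upd, vl_upd, if_pos rfl, if_neg hpq, hp.2.1] at h1
  omega

theorem exists_free {r : ℕ} {lam : Fin r → ℕ → ℕ}
    {D : Finset (Fin r × ℕ × ℕ)}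
    (hD : ∀ p, p ∈ D ↔ p.2.2 < lam p.1 p.2.1) {w : ℕ → ℕ} {T : Fin r → ℕ → ℕ → ℕ}
    (hT : MT lam D w T) (m : ℕ) (E F : Finset (Fin r × ℕ × ℕ))
    (hE : E.card ≤ F.card) (hF : F ⊆ D.filter fun p => vl T p = m + 2)
    (hFa : ∀ p ∈ F, ∀ a, p.2.1 = a + 1 → T p.1 a p.2.2 ≠ m + 1)
    (hw : w (m + 1) < w m) :
    ∃ q ∈ D, q ∉ E ∧ vl T q = m + 1 ∧ T q.1 (q.2.1 + 1) q.2.2 ≠ m + 2 := by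
  classical
  by_contra hcon
  push Not at hcon
  have h1 : ((D.filter fun p => vl T p = m + 1) \ E).card ≤
      ((D.filter fun p => vl T p = m + 2) \ F).card := by
    apply Finset.card_le_card_of_injOn (fun q => (q.1, q.2.1 + 1, q.2.2))
    · intro q hq
      have hq' : (q ∈ D ∧ vl T q = m + 1) ∧ q ∉ E := by simpa using hq
      obtain ⟨⟨hq1, hq2⟩, hq3⟩ := hq'
      have h := hcon q hq1 hq3 hq2
      have hgoal : (q.1, q.2.1 + 1, q.2.2) ∈ (D.filter fun p => vl T p = m + 2) \ F := by
        rw [Finset.mem_sdiff, Finset.mem_filter]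
        refine ⟨⟨?_, h⟩, ?_⟩
        · rw [hD]
          by_contra hlt
          have := (hT.1 q.1).2.1 (q.2.1 + 1) q.2.2 (by simpa using hlt)
          omega
        · intro hmem
          exact hFa _ hmem q.2.1 rfl hq2
      exact hgoal
    · rintro ⟨j, a, c⟩ _ ⟨j', a', c'⟩ _ h
      simp only [Prod.mk.injEq] at h ⊢
      omega
  have h2 := Finset.le_card_sdiff E (D.filter fun p => vl T p = m + 1)
  have h3 := Finset.card_sdiff_of_subset hF
  have h4 := Finset.card_le_card hF
  have h5 := hT.2 m
  have h6 := hT.2 (m + 1)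
  have h7 : (D.filter fun p => vl T p = m + 1 + 1).card = (D.filter fun p => vl T p = m + 2).card :=
    rfl
  omega

theorem two_step {r : ℕ} {lam : Fin r → ℕ → ℕ} (hlp : ∀ j, IsPartition (lam j))
    {D : Finset (Fin r × ℕ × ℕ)}
    (hD : ∀ p, p ∈ D ↔ p.2.2 < lam p.1 p.2.1) (w : ℕ → ℕ) (m : ℕ) (hw : w (m + 1) < w m)
    (h2 : Two lam D w) : Two lam D (mv w m (m + 1)) := by
  have key : ∀ T, MT lam D w T → ∃ p, Low lam T m p := by
    intro T hT
    obtain ⟨q, hq, -, h1, h2⟩ := exists_free hD hT m ∅ ∅ le_rfl (by simp) (by simp) hw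
    obtain ⟨c', hc'⟩ := exists_low hlp hT.1 m q.1 q.2.1 q.2.2 ((hD q).1 hq) h1 h2
    exact ⟨_, hc'⟩
  obtain ⟨T, T', hne, hT, hT'⟩ := h2
  obtain ⟨p, hp⟩ := key T hT
  obtain ⟨p', hp'⟩ := key T' hT'
  by_cases hU : upd T p (m + 2) = upd T' p' (m + 2)
  swap
  · exact ⟨_, _, hU, low_upd hlp hD hT m p hp, low_upd hlp hD hT' m p' hp'⟩
  have hU' : ∀ q, vl (upd T p (m + 2)) q = vl (upd T' p' (m + 2)) q := fun q => by rw [hU]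
  simp only [vl_upd] at hU'
  have hpp : p ≠ p' := by
    rintro rfl
    apply hne
    apply vl_ext
    intro q
    have := hU' q
    by_cases h : q = p
    · rw [h, hp.2.1, hp'.2.1]
    · simpa [h] using this
  have hagree : ∀ q, q ≠ p → q ≠ p' → vl T q = vl T' q := by
    intro q h1 h2
    simpa [h1, h2] using hU' q
  have hTp' : vl T p' = m + 2 := by
    have := hU' p'
    simpa [hpp.symm] using this
  have hT'p : vl T' p = m + 2 := by
    have := hU' p
    simpa [hpp] using this.symm
  have hp'D : p' ∈ D := (hD p').2 hp'.1
  obtain ⟨q, hq, hqp, hq1, hq2⟩ := exists_free hD hT m {p} {p'} (by simp) (by simp [hp'D, hTp'])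
    (by
      intro p0 hp0 a ha h
      rw [Finset.mem_singleton] at hp0
      subst hp0
      obtain ⟨j, a', c⟩ := p0
      simp only at ha h
      subst ha
      by_cases hc : (j, a, c) = p
      · subst hc
        exact hp.2.2.2 hTp'
      · have h5 := hagree (j, a, c) hc (by simp)
        have h6 := (hT'.1 j).2.2.2 a (a + 1) c (by omega) hp'.1
        have h7 := hp'.2.1
        simp only [vl] at h5 h7
        omega) hw
  rw [Finset.mem_singleton] at hqp
  by_cases hrow : q.1 = p.1 ∧ q.2.1 = p.2.1
  · have hqp' : q ≠ p' := by
      rintro rfl; omega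
    have h1 : vl T' q = m + 1 := by rw [← hagree q hqp hqp']; exact hq1
    have h2 : T' q.1 (q.2.1 + 1) q.2.2 ≠ m + 2 := by
      intro hb
      by_cases hb1 : (q.1, q.2.1 + 1, q.2.2) = p'
      · have := hp'.2.1
        rw [← hb1] at this
        simp only [vl] at this
        omega
      · have hb2 : (q.1, q.2.1 + 1, q.2.2) ≠ p := by
          intro h
          have : q.2.1 + 1 = p.2.1 := by rw [← h]
          omega
        have := hagree _ hb2 hb1
        simp only [vl] at this
        omega
    obtain ⟨c', hc'⟩ := exists_low hlp hT'.1 m q.1 q.2.1 q.2.2 ((hD q).1 hq) h1 h2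
    refine two_of_two_low hlp hD hT' m _ p' hc' hp' ?_
    intro h
    obtain ⟨j, a, c⟩ := p
    obtain ⟨j', a', c''⟩ := p'
    obtain ⟨j2, a2, c2⟩ := q
    simp only [Prod.mk.injEq] at h hrow
    obtain ⟨rfl, rfl, rfl⟩ := h
    obtain ⟨rfl, rfl⟩ := hrow
    have e1 := hp.2.1
    have e2 := hp'.2.1
    have l1 := hp.1
    have l2 := hp'.1
    simp only [vl] at *
    rcases le_total c c' with h | h
    · have := (hT'.1 j2).2.2.1 a2 c c' h l2
      omega
    · have := (hT.1 j2).2.2.1 a2 c' c h l1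
      omega
  · obtain ⟨c', hc'⟩ := exists_low hlp hT.1 m q.1 q.2.1 q.2.2 ((hD q).1 hq) hq1 hq2
    refine two_of_two_low hlp hD hT m _ p hc' hp ?_
    intro h
    apply hrow
    rw [← h]
    exact ⟨rfl, rfl⟩

/-- the superstandard multitableau -/
def sup0 {r : ℕ} (lam : Fin r → ℕ → ℕ) : Fin r → ℕ → ℕ → ℕ :=
  fun j a c => if c < lam j a then a + 1 else 0

theorem sup0_MT {r : ℕ} {lam : Fin r → ℕ → ℕ} (hlp : ∀ j, IsPartition (lam j))
    {D : Finset (Fin r × ℕ × ℕ)}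
    (hD : ∀ p, p ∈ D ↔ p.2.2 < lam p.1 p.2.1) : MT lam D (tildePart lam) (sup0 lam) := by
  constructor
  · intro j
    refine ⟨?_, ?_, ?_, ?_⟩
    · intro i c h; simp [sup0, h]
    · intro i c h; simp [sup0]; omega
    · intro i c k h1 h2
      have : c < lam j i := by omega
      simp [sup0, h2, this]
    · intro i i' c h1 h2
      have : c < lam j i := lt_of_lt_of_le h2 ((hlp j).1 h1.le)
      simp [sup0, h2, this, h1]
  · intro m
    rw [← row_count lam D hD m]
    congr 1
    apply Finset.filter_congr
    intro p hp
    simp [vl, sup0, (hD p).1 hp]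

/-- one modification at the end of a row -/
theorem upd_end {r : ℕ} {lam : Fin r → ℕ → ℕ} (hlp : ∀ j, IsPartition (lam j))
    {D : Finset (Fin r × ℕ × ℕ)}
    (hD : ∀ p, p ∈ D ↔ p.2.2 < lam p.1 p.2.1) {w : ℕ → ℕ} {T : Fin r → ℕ → ℕ → ℕ}
    (hT : MT lam D w T) (j : Fin r) (s t : ℕ) (hst : s < t) (hd : lam j (s + 1) < lam j s)
    (hv : T j s (lam j s - 1) = s + 1) :
    MT lam D (mv w s t) (upd T (j, s, lam j s - 1) (t + 1)) := by
  refine ⟨?_, upd_weight hT.2 _ ((hD _).2 ?_) s t hv (by omega)⟩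
  · apply upd_ssyt hlp hT.1
    · omega
    · omega
    · intro h; omega
    · intro h; omega
  · simp only; omega

theorem exists_desc {r : ℕ} {lam : Fin r → ℕ → ℕ} (a b : ℕ)
    (h : tildePart lam b < tildePart lam a) : ∃ j, lam j b < lam j a := by
  obtain ⟨j, -, hj⟩ := Finset.exists_lt_of_sum_lt h
  exact ⟨j, hj⟩

theorem two_base {r : ℕ} {lam : Fin r → ℕ → ℕ} (hlp : ∀ j, IsPartition (lam j))
    {D : Finset (Fin r × ℕ × ℕ)}
    (hD : ∀ p, p ∈ D ↔ p.2.2 < lam p.1 p.2.1)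
    (hcond : ∀ i, tildePart lam i - tildePart lam (i + 1) ≤ 1 ∨
        ∃ j1 j2 : Fin r, j1 ≠ j2 ∧
          lam j1 (i + 1) < lam j1 i ∧ lam j2 (i + 1) < lam j2 i)
    (s t : ℕ) (hst : s < t) (h1 : tildePart lam (s + 1) < tildePart lam s)
    (h2 : tildePart lam t < tildePart lam (t - 1))
    (h3 : t = s + 1 → tildePart lam t + 2 ≤ tildePart lam s) :
    Two lam D (mv (tildePart lam) s t) := by
  have h0 := sup0_MT hlp hD
  have hv : ∀ j s, lam j (s + 1) < lam j s → sup0 lam j s (lam j s - 1) = s + 1 := by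
    intro j s h
    have : lam j s - 1 < lam j s := by omega
    simp [sup0, this]
  by_cases ht : t = s + 1
  · have h4 := h3 ht
    subst ht
    rcases hcond s with h | ⟨j1, j2, hne, d1, d2⟩
    · omega
    refine ⟨_, _, ?_, upd_end hlp hD h0 j1 s (s + 1) hst d1 (hv _ _ d1),
      upd_end hlp hD h0 j2 s (s + 1) hst d2 (hv _ _ d2)⟩
    intro h
    have h5 := congrFun (congrFun (congrFun h j1) s) (lam j1 s - 1)
    simp only [upd, if_true, Prod.mk.injEq, hne, false_and, if_false, hv _ _ d1] at h5
    omega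
  · obtain ⟨u, rfl⟩ : ∃ u, t = u + 1 := ⟨t - 1, by omega⟩
    simp only [Nat.add_sub_cancel] at h2
    obtain ⟨j1, d1⟩ := exists_desc _ _ h1
    obtain ⟨j2, d2⟩ := exists_desc _ _ h2
    have A := upd_end hlp hD h0 j1 s (u + 1) hst d1 (hv _ _ d1)
    have B := upd_end hlp hD h0 j1 s u (by omega) d1 (hv _ _ d1)
    have hus : u ≠ s := by omega
    have C := upd_end hlp hD B j2 u (u + 1) (by omega) d2 (by
      simp only [upd, Prod.mk.injEq, hus, false_and, and_false, if_false, hv _ _ d2])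
    have hw : mv (mv (tildePart lam) s u) u (u + 1) = mv (tildePart lam) s (u + 1) := by
      funext x
      unfold mv
      by_cases x1 : x = s
      · rw [if_neg (show x ≠ u by omega), if_neg (show x ≠ u + 1 by omega), if_pos x1, if_pos x1]
      · by_cases x2 : x = u
        · simp [x2, hus]
        · simp [x1, x2]
    rw [hw] at C
    refine ⟨_, _, ?_, A, C⟩
    intro h
    have h5 := congrFun (congrFun (congrFun h j1) s) (lam j1 s - 1)
    simp only [upd, if_true, Prod.mk.injEq, hus.symm, false_and, and_false, if_false] at h5
    omega

theorem unique_sup {r : ℕ} {lam : Fin r → ℕ → ℕ} (hlp : ∀ j, IsPartition (lam j))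
    {D : Finset (Fin r × ℕ × ℕ)}
    (hD : ∀ p, p ∈ D ↔ p.2.2 < lam p.1 p.2.1) (T : Fin r → ℕ → ℕ → ℕ)
    (hT : MT lam D (tildePart lam) T) : T = sup0 lam := by
  funext j a c
  unfold sup0
  split_ifs with h
  · have h1 := ssyt_row_le (hlp j).1 (hT.1 j) a c h
    have h2 := entry_le hlp hD hT (a + 1) rfl (j, a, c) ((hD _).2 h) (Nat.lt_succ_self a)
    exact le_antisymm h2 h1
  · exact (hT.1 j).2.1 _ _ (by omega)

theorem unique_bad {r : ℕ} {lam : Fin r → ℕ → ℕ} (hlp : ∀ j, IsPartition (lam j))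
    {D : Finset (Fin r × ℕ × ℕ)}
    (hD : ∀ p, p ∈ D ↔ p.2.2 < lam p.1 p.2.1) (i : ℕ) (j0 : Fin r)
    (hd : lam j0 (i + 1) < lam j0 i) (hj0 : ∀ j, j ≠ j0 → lam j i ≤ lam j (i + 1))
    (hpos : 0 < tildePart lam i)
    (T : Fin r → ℕ → ℕ → ℕ)
    (hT : MT lam D (mv (tildePart lam) i (i + 1)) T) :
    T = upd (sup0 lam) (j0, i, lam j0 i - 1) (i + 2) := by
  classical
  have hps : ∀ k, k ≠ i + 1 → psum (mv (tildePart lam) i (i + 1)) k = psum (tildePart lam) k := by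
    intro k hk
    have := psum_mv (tildePart lam) i (i + 1) (by omega) hpos k
    rw [if_neg (by omega)] at this
    omega
  have hge : ∀ p ∈ D, p.2.1 + 1 ≤ vl T p := fun p hp =>
    ssyt_row_le (hlp p.1).1 (hT.1 p.1) p.2.1 p.2.2 ((hD p).1 hp)
  have hother : ∀ p ∈ D, p.2.1 ≠ i → vl T p = p.2.1 + 1 := by
    intro p hp h
    apply le_antisymm _ (hge p hp)
    exact entry_le hlp hD hT (p.2.1 + 1) (hps _ (by omega)) p hp (Nat.lt_succ_self _)
  have hi2 : ∀ p ∈ D, p.2.1 = i → vl T p ≤ i + 2 := by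
    intro p hp h
    exact entry_le hlp hD hT (i + 2) (hps _ (by omega)) p hp (by omega)
  have hcnt : (D.filter fun p => vl T p = i + 1).card = tildePart lam i - 1 := by
    rw [hT.2 i]; simp [mv]
  have hrc := row_count lam D hD i
  have hsub : (D.filter fun p => vl T p = i + 1) ⊆ D.filter fun p => p.2.1 + 1 = i + 1 := by
    intro p hp
    rw [Finset.mem_filter] at hp ⊢
    refine ⟨hp.1, ?_⟩
    by_contra h
    have := hother p hp.1 (by omega)
    omega
  obtain ⟨q, hq1, hq2⟩ := Finset.exists_mem_notMem_of_card_lt_card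
    (s := D.filter fun p => vl T p = i + 1) (t := D.filter fun p => p.2.1 + 1 = i + 1) (by omega)
  rw [Finset.mem_filter] at hq1 hq2
  have hqv : vl T q = i + 2 := by
    have a1 := hi2 q hq1.1 (by omega)
    have a2 := hge q hq1.1
    have : vl T q ≠ i + 1 := fun h => hq2 ⟨hq1.1, h⟩
    omega
  obtain ⟨j, a, c⟩ := q
  obtain ⟨hqD, ha⟩ := hq1
  simp only [Nat.add_right_cancel_iff] at ha
  subst ha
  have hqc : c < lam j a := (hD _).1 hqD
  have hjj : j = j0 := by
    by_contra hne
    have hl : c < lam j (a + 1) := lt_of_lt_of_le hqc (hj0 j hne)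
    have h1 := hother (j, a + 1, c) ((hD _).2 hl) (by simp)
    have h2 := (hT.1 j).2.2.2 a (a + 1) c (by omega) hl
    simp only [vl] at h1 hqv
    omega
  subst hjj
  have hlastD : (j, a, lam j a - 1) ∈ D := by rw [hD]; simp only; omega
  have hlast : vl T (j, a, lam j a - 1) = a + 2 := by
    apply le_antisymm (hi2 _ hlastD rfl)
    rw [← hqv]
    exact (hT.1 j).2.2.1 a c (lam j a - 1) (by omega) (by omega)
  have heq : (D.filter fun p => vl T p = a + 1) =
      (D.filter fun p => p.2.1 + 1 = a + 1).erase (j, a, lam j a - 1) := by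
    apply Finset.eq_of_subset_of_card_le
    · intro p hp
      rw [Finset.mem_erase]
      refine ⟨?_, hsub hp⟩
      rintro rfl
      have := (Finset.mem_filter.1 hp).2
      omega
    · rw [Finset.card_erase_of_mem (by simp [hlastD]), hrc, hcnt]
  apply vl_ext
  intro p
  rw [vl_upd]
  split_ifs with h
  · rw [h, hlast]
  · by_cases hp : p ∈ D
    · have hs : vl (sup0 lam) p = p.2.1 + 1 := by
        simp [vl, sup0, (hD p).1 hp]
      rw [hs]
      by_cases hpi : p.2.1 = a
      · have : p ∈ (D.filter fun p => p.2.1 + 1 = a + 1).erase (j, a, lam j a - 1) := by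
          rw [Finset.mem_erase, Finset.mem_filter]
          exact ⟨h, hp, by omega⟩
        rw [← heq, Finset.mem_filter] at this
        omega
      · exact hother p hp hpi
    · have hp' : lam p.1 p.2.1 ≤ p.2.2 := by
        rw [hD] at hp; omega
      have h1 : vl T p = 0 := (hT.1 p.1).2.1 _ _ hp'
      rw [h1]
      simp [vl, sup0, hp']

theorem psize_eq_s17 (l : ℕ → ℕ) (N k : ℕ) (h : ∀ i, N ≤ i → l i = 0) (hk : N ≤ k) :
    psize l = psum l k := by
  unfold psize psum
  apply finsum_eq_sum_of_support_subset
  intro x hx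
  rw [Function.mem_support] at hx
  rw [Finset.coe_range, Set.mem_Iio]
  by_contra hcon
  exact hx (h x (by omega))

theorem stmt17 (r n : ℕ) (lam : Fin r → ℕ → ℕ)
    (hlp : ∀ j, IsPartition (lam j)) (hln : (∑ j, psize (lam j)) = n) :
    (∀ mu : ℕ → ℕ, IsPartition mu → psize mu = n →
        (kostkaMulti lam mu = 1 ↔ mu = tildePart lam)) ↔
      (∀ i, tildePart lam i - tildePart lam (i + 1) ≤ 1 ∨
        ∃ j1 j2 : Fin r, j1 ≠ j2 ∧
          lam j1 (i + 1) < lam j1 i ∧ lam j2 (i + 1) < lam j2 i) := by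
  obtain ⟨D, N, hD, hN⟩ := exists_cells lam hlp
  have hk : ∀ w, kostkaMulti lam w = Set.ncard {T | MT lam D w T} := by
    intro w
    unfold kostkaMulti
    congr 1
    ext T
    exact multi_iff lam D hD w T
  have htanti : Antitone (tildePart lam) := fun a b hab =>
    Finset.sum_le_sum fun j _ => (hlp j).1 hab
  have htz : ∀ i, N ≤ i → tildePart lam i = 0 := fun i hi =>
    Finset.sum_eq_zero fun j _ => hN j i hi
  have hsz : ∀ k, N ≤ k → psum (tildePart lam) k = n := by
    intro k hk
    rw [← hln]
    unfold psum tildePart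
    rw [Finset.sum_comm]
    apply Finset.sum_congr rfl
    intro j _
    exact (psize_eq_s17 (lam j) N k (hN j) hk).symm
  constructor
  · intro H i
    by_contra hcon
    push Not at hcon
    obtain ⟨hgt, huniq⟩ := hcon
    obtain ⟨j0, hd⟩ := exists_desc (lam := lam) i (i + 1) (by omega)
    have hj0 : ∀ j, j ≠ j0 → lam j i ≤ lam j (i + 1) := fun j hj => huniq j0 j hj.symm hd
    have hiN : i < N := by
      by_contra h
      have := htz i (by omega)
      omega
    have hmvz : ∀ x, N + 1 ≤ x → mv (tildePart lam) i (i + 1) x = 0 := by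
      intro x hx
      unfold mv
      rw [if_neg (by omega), if_neg (by omega)]
      exact htz x (by omega)
    have hpart : IsPartition (mv (tildePart lam) i (i + 1)) := by
      refine ⟨antitone_nat_of_succ_le ?_, N + 1, hmvz⟩
      intro x
      have hx := htanti (Nat.le_succ x)
      simp only [Nat.succ_eq_add_one] at hx
      unfold mv
      by_cases h1 : x = i
      · subst h1
        simp
        omega
      · by_cases h2 : x = i + 1
        · subst h2
          rw [if_neg (by omega), if_neg (by omega), if_neg (by omega), if_pos rfl]
          omega
        · rw [if_neg h1, if_neg h2]
          by_cases h3 : x + 1 = i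
          · rw [if_pos h3]; omega
          · rw [if_neg h3, if_neg (by omega)]; exact hx
    have hsize : psize (mv (tildePart lam) i (i + 1)) = n := by
      rw [psize_eq_s17 _ (N + 1) (N + 1) hmvz le_rfl]
      have := psum_mv (tildePart lam) i (i + 1) (by omega) (by omega) (N + 1)
      rw [if_neg (by omega)] at this
      rw [← hsz (N + 1) (by omega), ← this]
      simp
    have hone : kostkaMulti lam (mv (tildePart lam) i (i + 1)) = 1 := by
      rw [hk, Set.ncard_eq_one]
      refine ⟨upd (sup0 lam) (j0, i, lam j0 i - 1) (i + 2), ?_⟩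
      ext T
      rw [Set.mem_singleton_iff, Set.mem_ofPred_eq]
      constructor
      · exact unique_bad hlp hD i j0 hd hj0 (by omega) T
      · rintro rfl
        apply upd_end hlp hD (sup0_MT hlp hD) j0 i (i + 1) (by omega) hd
        have : lam j0 i - 1 < lam j0 i := by omega
        simp [sup0, this]
    have heq := congrFun ((H _ hpart hsize).1 hone) i
    simp only [mv, if_true] at heq
    omega
  · intro hcond mu hmu hsize
    constructor
    · intro h
      rw [hk, Set.ncard_eq_one] at h
      obtain ⟨T, hT⟩ := h
      have hTm : MT lam D mu T := by
        have : T ∈ {T | MT lam D mu T} := by rw [hT]; rfl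
        exact this
      by_contra hne
      obtain ⟨M, hM⟩ := hmu.2
      have hdom := dom_of_MT hlp hD hTm
      have hend : ∀ k, max N M ≤ k → psum (tildePart lam) k = psum mu k := by
        intro k hk
        rw [hsz k (le_trans (le_max_left _ _) hk), ← hsize]
        exact psize_eq_s17 mu M k hM (le_trans (le_max_right _ _) hk)
      obtain ⟨s, t, hst, hs, ht, hu, hgap⟩ :=
        find_st mu (tildePart lam) (max N M) hdom hend (Ne.symm hne)
      have hms := hmu.1 (Nat.le_succ s)
      have hmt := hmu.1 (Nat.sub_le t 1)
      simp only [Nat.succ_eq_add_one] at hms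
      have hbase : Two lam D (mv (tildePart lam) s t) := by
        by_cases h : t = s + 1
        · subst h
          simp only [Nat.add_sub_cancel] at hmt
          apply two_base hlp hD hcond s (s + 1) hst
          · omega
          · simp only [Nat.add_sub_cancel]; omega
          · intro _; omega
        · have e1 := hu (s + 1) (by omega) (by omega)
          have e2 := hu (t - 1) (by omega) (by omega)
          apply two_base hlp hD hcond s t hst
          · omega
          · omega
          · intro h'; omega
      have hp := psum_mv (tildePart lam) s t hst (by omega)
      have htM : t < max N M := by
        by_contra hc
        have := hM t (le_trans (le_max_right N M) (by omega))
        omega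
      have h2 : Two lam D mu := by
        refine chain (Two lam D) mu hmu.1 (max N M) (fun w m => two_step hlp hD w m) _ _ rfl
          ?_ ?_ hbase
        · intro k
          have h1 := hp k
          split_ifs at h1 with h
          · have := hgap k h.1 h.2
            omega
          · have := hdom k
            omega
        · intro k hk
          have h1 := hp k
          rw [if_neg (by omega)] at h1
          have := hend k hk
          omega
      obtain ⟨T1, T2, hne', h1, h2⟩ := h2
      have a1 : T1 ∈ {T | MT lam D mu T} := h1
      have a2 : T2 ∈ {T | MT lam D mu T} := h2
      rw [hT, Set.mem_singleton_iff] at a1 a2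
      exact hne' (a1.trans a2.symm)
    · rintro rfl
      rw [hk, Set.ncard_eq_one]
      refine ⟨sup0 lam, ?_⟩
      ext T
      rw [Set.mem_singleton_iff, Set.mem_ofPred_eq]
      constructor
      · exact unique_sup hlp hD T
      · rintro rfl
        exact sup0_MT hlp hD
end
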